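/- Let R be a commutative Noetherian ring and let A, A' be nullity classes in D_qc(R). Then A ⊆ A' if and only if φ(A)(n) ⊆ φ(A')(n) for every n ∈ ℤ. In particular, the assignment A ↦ φ(A) is injective on nullity classes in D_qc(R). -/

import Mathlib

open CategoryTheory CategoryTheory.Limits CategoryTheory.Pretriangulated

universe w

section Defs

variable (R : Type) [CommRing R] [HasDerivedCategory.{w} (ModuleCat R)]

/-- The `n`-th homology (homological indexing, so that `H_n (s M) = H_{n-1} M` where
`s = ⟦1⟧`) of an object of the derived category `D(R)` of `R`-modules. -/
noncomputable def Hh (n : ℤ) (M : DerivedCategory (ModuleCat R)) : ModuleCat R :=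
  (DerivedCategory.homologyFunctor (ModuleCat R) (-n)).obj M

/-- The object `s^n M` of `D(R)` given by a module `M` concentrated in homological
degree `n`. -/
noncomputable def sdeg (n : ℤ) (M : ModuleCat R) : DerivedCategory (ModuleCat R) :=
  (DerivedCategory.singleFunctor (ModuleCat R) (-n)).obj M

/-- Membership in `D_qc(R)`: all homology modules are finitely generated over `R`,
and all but finitely many of them vanish. -/
def memDqc (M : DerivedCategory (ModuleCat R)) : Prop :=
  (∀ n : ℤ, Module.Finite R ↥(Hh R n M)) ∧
    {n : ℤ | ¬ IsZero (Hh R n M)}.Finite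

/-- A cocomplete preaisle in `D(R)`: a class of objects closed under isomorphism,
suspension (`s = ⟦1⟧`), extensions, and arbitrary coproducts. -/
structure IsCocompletePreaisle (S : Set (DerivedCategory (ModuleCat R))) : Prop where
  mem_of_iso : ∀ ⦃X Y : DerivedCategory (ModuleCat R)⦄, (X ≅ Y) → X ∈ S → Y ∈ S
  shift_mem : ∀ ⦃X : DerivedCategory (ModuleCat R)⦄, X ∈ S → X⟦(1 : ℤ)⟧ ∈ S
  ext_mem : ∀ ⦃X Y Z : DerivedCategory (ModuleCat R)⦄ (f : X ⟶ Y) (g : Y ⟶ Z)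
    (h : Z ⟶ X⟦(1 : ℤ)⟧),
    (Triangle.mk f g h ∈ distTriang (DerivedCategory (ModuleCat R))) →
    X ∈ S → Z ∈ S → Y ∈ S
  coproduct_mem : ∀ ⦃ι : Type⦄ (X : ι → DerivedCategory (ModuleCat R)) (c : Cofan X),
    IsColimit c → (∀ i, X i ∈ S) → c.pt ∈ S

end Defs

section Invariants

variable (R : Type) [CommRing R] [HasDerivedCategory.{w} (ModuleCat R)]

/-- The invariant `φ`: for a class `A` of objects of `D_qc(R)` and `n : ℤ`,
`φ(A)(n)` is the set of primes `p` such that there are `M ∈ A` and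
`q ∈ Ass H_n(M)` with `q ⊆ p`. -/
noncomputable def phi (A : Set (DerivedCategory (ModuleCat R))) (n : ℤ) :
    Set (PrimeSpectrum R) :=
  {p | ∃ M ∈ A, ∃ q ∈ associatedPrimes R ↥(Hh R n M), q ≤ p.asIdeal}

/-- `N(f)`: the intersection with `D_qc(R)` of the smallest cocomplete preaisle of
`D(R)` containing `s^n (R/p)` for every `n : ℤ` and every `p ∈ f(n)`. -/
noncomputable def Nfun (f : ℤ → Set (PrimeSpectrum R)) :
    Set (DerivedCategory (ModuleCat R)) :=
  {M | memDqc R M ∧ ∀ S : Set (DerivedCategory (ModuleCat R)), IsCocompletePreaisle R S →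
    (∀ (n : ℤ), ∀ p ∈ f n, sdeg R n (ModuleCat.of R (R ⧸ p.asIdeal)) ∈ S) → M ∈ S}

/-- A nullity class in `D_qc(R)`: the intersection of a cocomplete preaisle of `D(R)`
with `D_qc(R)`. -/
def IsNullityClass (A : Set (DerivedCategory (ModuleCat R))) : Prop :=
  ∃ U : Set (DerivedCategory (ModuleCat R)), IsCocompletePreaisle R U ∧
    A = U ∩ {M | memDqc R M}

end Invariants


universe v
open scoped TensorProduct

namespace Nul
variable {R : Type} [CommRing R]

abbrev Cx (R : Type) [CommRing R] := CochainComplex (ModuleCat.{v} R) ℤ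

lemma sigma_i_e (X : ℕ → Cx.{v} R) (k : ℕ) (s : Finset ℕ) (hk : k ∈ s) :
    Sigma.ι X k ≫ (∑ k ∈ s, (Sigma.π X k ≫ Sigma.ι X k)) = Sigma.ι X k := by
  rw [Preadditive.comp_sum, Finset.sum_eq_single k]
  · simp
  · intro b _ hb
    rw [← Category.assoc, Sigma.ι_π_of_ne X hb.symm, zero_comp]
  · intro h; exact absurd hk h

def sigmaSub (X : ℕ → Cx.{v} R) (i : ℤ) : Submodule R ((∐ X).X i) where
  carrier := {x | ∃ s0 : Finset ℕ, ∀ s, s0 ⊆ s → (∑ k ∈ s, (Sigma.π X k ≫ Sigma.ι X k)).f i x = x}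
  add_mem' := by
    rintro a b ⟨s, hs⟩ ⟨t, ht⟩
    refine ⟨s ∪ t, fun u hu => ?_⟩
    rw [map_add, hs u (Finset.union_subset_left hu), ht u (Finset.union_subset_right hu)]
  zero_mem' := ⟨∅, fun s _ => by rw [map_zero]⟩
  smul_mem' := by
    rintro c a ⟨s, hs⟩
    refine ⟨s, fun u hu => ?_⟩
    rw [map_smul, hs u hu]

lemma sigma_elem (X : ℕ → Cx.{v} R) (i : ℤ) (x : (∐ X).X i) :
    ∃ s : Finset ℕ, (∑ k ∈ s, (Sigma.π X k ≫ Sigma.ι X k)).f i x = x := by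
  have h : ModuleCat.ofHom (sigmaSub X i).mkQ = 0 := by
    have hc := isColimitOfPreserves (HomologicalComplex.eval (ModuleCat.{v} R) (ComplexShape.up ℤ) i)
      (coproductIsCoproduct X)
    apply hc.hom_ext
    rintro ⟨k⟩
    ext y
    have : (Sigma.ι X k).f i y ∈ sigmaSub X i := by
      refine ⟨{k}, fun s hs => ?_⟩
      have := sigma_i_e X k s (hs (Finset.mem_singleton_self k))
      have h2 := congrArg (fun (g : X k ⟶ ∐ X) => g.f i y) this
      exact h2
    change (sigmaSub X i).mkQ ((Sigma.ι X k).f i y) = 0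
    rw [Submodule.mkQ_apply, Submodule.Quotient.mk_eq_zero]
    exact this
  have hx : (sigmaSub X i).mkQ x = 0 := by
    have := congrArg (fun g => g.hom x) h
    simpa using this
  rw [Submodule.mkQ_apply, Submodule.Quotient.mk_eq_zero] at hx
  obtain ⟨s, hs⟩ := hx
  exact ⟨s, hs s subset_rfl⟩

lemma sigma_homology (X : ℕ → Cx.{v} R) (i : ℤ) (z : (∐ X).homology i) :
    ∃ s : Finset ℕ, z = ∑ k ∈ s, (HomologicalComplex.homologyMap (Sigma.ι X k) i)
      ((HomologicalComplex.homologyMap (Sigma.π X k) i) z) := by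
  obtain ⟨c, rfl⟩ := (ModuleCat.epi_iff_surjective ((∐ X).homologyπ i)).1 inferInstance z
  obtain ⟨s, hs⟩ := sigma_elem X i ((∐ X).iCycles i c)
  refine ⟨s, ?_⟩
  set e := ∑ k ∈ s, (Sigma.π X k ≫ Sigma.ι X k) with he
  have h1 : HomologicalComplex.cyclesMap e i c = c := by
    apply (ModuleCat.mono_iff_injective ((∐ X).iCycles i)).1 inferInstance
    rw [← ModuleCat.comp_apply, HomologicalComplex.cyclesMap_i, ModuleCat.comp_apply, hs]
  have h2 : HomologicalComplex.homologyMap e i ((∐ X).homologyπ i c) = (∐ X).homologyπ i c := by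
    rw [← ModuleCat.comp_apply, HomologicalComplex.homologyπ_naturality, ModuleCat.comp_apply, h1]
  have h3 : HomologicalComplex.homologyMap e i = ∑ k ∈ s, HomologicalComplex.homologyMap (Sigma.π X k) i ≫ HomologicalComplex.homologyMap (Sigma.ι X k) i := by
    have := (HomologicalComplex.homologyFunctor (ModuleCat.{v} R) (ComplexShape.up ℤ) i).map_sum
      (fun k => Sigma.π X k ≫ Sigma.ι X k) s
    simp [HomologicalComplex.homologyMap_comp] at this
    exact this
  conv_lhs => rw [← h2, h3]
  simp

lemma quasiIso_iff_bij {K L : Cx.{v} R} (f : K ⟶ L) : QuasiIso f ↔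
    ∀ i, Function.Bijective (HomologicalComplex.homologyMap f i) := by
  rw [quasiIso_iff]
  refine forall_congr' fun i => ?_
  rw [quasiIsoAt_iff_isIso_homologyMap, ConcreteCategory.isIso_iff_bijective]

lemma sigma_quasiIso (X' X : ℕ → Cx.{v} R) (s : ∀ k, X' k ⟶ X k) (hs : ∀ k, QuasiIso (s k)) :
    QuasiIso (Limits.Sigma.map s) := by
  rw [quasiIso_iff_bij]
  intro i
  have hb := fun k => (quasiIso_iff_bij (s k)).1 (hs k) i
  have e1 : ∀ k z, HomologicalComplex.homologyMap (Sigma.π X k) i (HomologicalComplex.homologyMap (Limits.Sigma.map s) i z)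
     = HomologicalComplex.homologyMap (s k) i (HomologicalComplex.homologyMap (Sigma.π X' k) i z) := by
    intro k z
    rw [← ModuleCat.comp_apply, ← ModuleCat.comp_apply, ← HomologicalComplex.homologyMap_comp,
     ← HomologicalComplex.homologyMap_comp]
    congr 3
    apply Sigma.hom_ext
    intro l
    by_cases h : l = k
    · subst h; simp
    · simp [Sigma.ι_π_of_ne_assoc, Sigma.ι_π_of_ne, h]
  constructor
  · rw [injective_iff_map_eq_zero]
    intro z hz
    obtain ⟨t, ht⟩ := sigma_homology X' i z
    rw [ht]
    refine Finset.sum_eq_zero fun k _ => ?_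
    have : HomologicalComplex.homologyMap (Sigma.π X' k) i z = 0 := by
      apply (hb k).1
      rw [← e1, hz]; simp
    rw [this]; simp
  · intro z
    obtain ⟨t, ht⟩ := sigma_homology X i z
    choose u hu using fun k => (hb k).2 (HomologicalComplex.homologyMap (Sigma.π X k) i z)
    refine ⟨∑ k ∈ t, HomologicalComplex.homologyMap (Sigma.ι X' k) i (u k), ?_⟩
    rw [map_sum, ht]
    refine Finset.sum_congr rfl fun k _ => ?_
    rw [← hu, ← ModuleCat.comp_apply, ← ModuleCat.comp_apply, ← HomologicalComplex.homologyMap_comp,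
     ← HomologicalComplex.homologyMap_comp]
    simp

end Nul

namespace Nul
variable {R : Type} [CommRing R] [HasDerivedCategory.{w} (ModuleCat.{v} R)]

abbrev DR (R : Type) [CommRing R] [HasDerivedCategory.{w} (ModuleCat.{v} R)] := DerivedCategory (ModuleCat.{v} R)

noncomputable abbrev HH (i : ℤ) (X : DR.{w, v} R) : ModuleCat.{v} R :=
  (DerivedCategory.homologyFunctor (ModuleCat.{v} R) i).obj X

noncomputable def hm (i : ℤ) {X Y : DR.{w, v} R} (f : X ⟶ Y) : HH i X →ₗ[R] HH i Y :=
  ((DerivedCategory.homologyFunctor (ModuleCat.{v} R) i).map f).hom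

lemma hm_comp (i : ℤ) {X Y Z : DR.{w, v} R} (f : X ⟶ Y) (g : Y ⟶ Z) (x : HH i X) :
    hm i (f ≫ g) x = hm i g (hm i f x) := by
  unfold hm; rw [Functor.map_comp]; rfl

lemma hm_id (i : ℤ) {X : DR.{w, v} R} (x : HH i X) : hm i (𝟙 X) x = x := by
  unfold hm; rw [CategoryTheory.Functor.map_id]; rfl

lemma hm_zero (i : ℤ) {X Y : DR.{w, v} R} (x : HH i X) : hm i (0 : X ⟶ Y) x = 0 := by
  unfold hm; rw [Functor.map_zero]; rfl

lemma hm_add (i : ℤ) {X Y : DR.{w, v} R} (f g : X ⟶ Y) (x : HH i X) :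
    hm i (f + g) x = hm i f x + hm i g x := by
  unfold hm; rw [Functor.map_add]; rfl

lemma hm_sub (i : ℤ) {X Y : DR.{w, v} R} (f g : X ⟶ Y) (x : HH i X) :
    hm i (f - g) x = hm i f x - hm i g x := by
  unfold hm; rw [Functor.map_sub]; rfl

lemma isIso_of_hm {X Y : DR.{w, v} R} (f : X ⟶ Y) (h : ∀ i, Function.Bijective (hm i f)) : IsIso f := by
  rw [DerivedCategory.isIso_iff]
  intro n
  rw [ConcreteCategory.isIso_iff_bijective]
  exact h n

lemma hm_exact2 {X Y Z : DR.{w, v} R} (f : X ⟶ Y) (g : Y ⟶ Z) (h : Z ⟶ X⟦(1 : ℤ)⟧)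
    (hT : Triangle.mk f g h ∈ distTriang _) (i : ℤ) (y : HH i Y) (hy : hm i g y = 0) :
    ∃ x, hm i f x = y := by
  have := DerivedCategory.HomologySequence.exact₂ _ hT i
  rw [ShortComplex.moduleCat_exact_iff] at this
  exact this y hy

/-- the connecting map -/
lemma hm_exact3 {X Y Z : DR.{w, v} R} (f : X ⟶ Y) (g : Y ⟶ Z) (h : Z ⟶ X⟦(1 : ℤ)⟧)
    (hT : Triangle.mk f g h ∈ distTriang _) (i : ℤ) :
    ∃ d : HH i Z →ₗ[R] HH (i+1) X, (∀ y, d (hm i g y) = 0) ∧ (∀ z, hm (i+1) f (d z) = 0) ∧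
     (∀ z, d z = 0 → ∃ y, hm i g y = z) ∧ (∀ x, hm (i+1) f x = 0 → ∃ z, d z = x) := by
  have h3 := DerivedCategory.HomologySequence.exact₃ _ hT i (i+1) rfl
  have h1 := DerivedCategory.HomologySequence.exact₁ _ hT i (i+1) rfl
  rw [ShortComplex.moduleCat_exact_iff] at h3 h1
  refine ⟨(DerivedCategory.HomologySequence.δ (Triangle.mk f g h) i (i+1) rfl).hom, ?_, ?_, h3, h1⟩
  · intro y
    exact congrArg (fun (f : HH i Y ⟶ HH (i+1) X) => f.hom y) (DerivedCategory.HomologySequence.comp_δ _ hT i (i+1) rfl)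
  · intro y
    exact congrArg (fun (f : HH i Z ⟶ HH (i+1) Y) => f.hom y) (DerivedCategory.HomologySequence.δ_comp _ hT i (i+1) rfl)

lemma hm_comp_zero {X Y Z : DR.{w, v} R} (f : X ⟶ Y) (g : Y ⟶ Z) (h : Z ⟶ X⟦(1 : ℤ)⟧)
    (hT : Triangle.mk f g h ∈ distTriang _) (i : ℤ) (x : HH i X) : hm i g (hm i f x) = 0 := by
  have h0 : f ≫ g = 0 := comp_distTriang_mor_zero₁₂ _ hT
  rw [← hm_comp, h0, hm_zero]

lemma coy2 {X Y Z : DR.{w, v} R} {f : X ⟶ Y} {g : Y ⟶ Z} {h : Z ⟶ X⟦(1 : ℤ)⟧}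
    (hT : Triangle.mk f g h ∈ distTriang _) {A : DR.{w, v} R} (a : A ⟶ Y) (ha : a ≫ g = 0) :
    ∃ b : A ⟶ X, a = b ≫ f := Triangle.coyoneda_exact₂ _ hT a ha

lemma coy3 {X Y Z : DR.{w, v} R} {f : X ⟶ Y} {g : Y ⟶ Z} {h : Z ⟶ X⟦(1 : ℤ)⟧}
    (hT : Triangle.mk f g h ∈ distTriang _) {A : DR.{w, v} R} (a : A ⟶ Z) (ha : a ≫ h = 0) :
    ∃ b : A ⟶ Y, a = b ≫ g := Triangle.coyoneda_exact₃ _ hT a ha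

lemma yon2 {X Y Z : DR.{w, v} R} {f : X ⟶ Y} {g : Y ⟶ Z} {h : Z ⟶ X⟦(1 : ℤ)⟧}
    (hT : Triangle.mk f g h ∈ distTriang _) {A : DR.{w, v} R} (a : Y ⟶ A) (ha : f ≫ a = 0) :
    ∃ b : Z ⟶ A, a = g ≫ b := Triangle.yoneda_exact₂ _ hT a ha

lemma yon3 {X Y Z : DR.{w, v} R} {f : X ⟶ Y} {g : Y ⟶ Z} {h : Z ⟶ X⟦(1 : ℤ)⟧}
    (hT : Triangle.mk f g h ∈ distTriang _) {A : DR.{w, v} R} (a : Z ⟶ A) (ha : g ≫ a = 0) :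
    ∃ b : X⟦(1 : ℤ)⟧ ⟶ A, a = h ≫ b := Triangle.yoneda_exact₃ _ hT a ha

lemma hQ_nat {K L : Cx.{v} R} (f : K ⟶ L) (i : ℤ) (x : K.homology i) :
    hm i (DerivedCategory.Q.map f) ((DerivedCategory.homologyFunctorFactors _ i).inv.app K x)
    = (DerivedCategory.homologyFunctorFactors _ i).inv.app L (HomologicalComplex.homologyMap f i x) := by
  have := (DerivedCategory.homologyFunctorFactors (ModuleCat.{v} R) i).inv.naturality f
  exact (congrArg (fun (f : K.homology i ⟶ HH i (DerivedCategory.Q.obj L)) => f.hom x) this).symm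

lemma sigmaQ_span (X : ℕ → Cx.{v} R) (i : ℤ) (z : HH i (DerivedCategory.Q.obj (∐ X))) :
    ∃ s : Finset ℕ, ∃ x : ∀ k, HH i (DerivedCategory.Q.obj (X k)),
      z = ∑ k ∈ s, hm i (DerivedCategory.Q.map (Sigma.ι X k)) (x k) := by
  set e := DerivedCategory.homologyFunctorFactors (ModuleCat.{v} R) i
  obtain ⟨s, hs⟩ := sigma_homology X i (e.hom.app _ z)
  refine ⟨s, fun k => e.inv.app _ (HomologicalComplex.homologyMap (Sigma.π X k) i (e.hom.app _ z)), ?_⟩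
  have h0 : z = e.inv.app _ (e.hom.app _ z) := by
    rw [← ModuleCat.comp_apply, Iso.hom_inv_id_app]; rfl
  conv_lhs => rw [h0, hs]
  erw [map_sum]
  refine Finset.sum_congr rfl fun k _ => ?_
  rw [hQ_nat]

lemma sigmaQ_desc (X : ℕ → Cx.{v} R) (Y : DR.{w, v} R) (f : ∀ k, DerivedCategory.Q.obj (X k) ⟶ Y) :
    ∃ g : DerivedCategory.Q.obj (∐ X) ⟶ Y, ∀ k, DerivedCategory.Q.map (Sigma.ι X k) ≫ g = f k := by
  let e := DerivedCategory.Q.objObjPreimageIso Y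
  choose X' s hs g hg using fun k => DerivedCategory.right_fac (f k ≫ e.inv)
  have hs' : ∀ k, QuasiIso (s k) := fun k => (DerivedCategory.isIso_Q_map_iff_quasiIso _ _).1 (hs k)
  have h1 := sigma_quasiIso X' X s hs'
  have h2 := (DerivedCategory.isIso_Q_map_iff_quasiIso _ _).2 h1
  refine ⟨inv (DerivedCategory.Q.map (Limits.Sigma.map s)) ≫ DerivedCategory.Q.map (Sigma.desc g) ≫ e.hom, fun k => ?_⟩
  have hk := hg k
  rw [← cancel_mono e.inv, hk, ← cancel_epi (DerivedCategory.Q.map (s k))]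
  simp only [Category.assoc, Iso.hom_inv_id, Category.comp_id, IsIso.hom_inv_id_assoc]
  rw [← Functor.map_comp_assoc]
  have : s k ≫ Sigma.ι X k = Sigma.ι X' k ≫ Limits.Sigma.map s := by simp
  rw [this, Functor.map_comp, Category.assoc, IsIso.hom_inv_id_assoc, ← Functor.map_comp]
  simp

lemma sigmaQ_zero (X : ℕ → Cx.{v} R) (Y : DR.{w, v} R) (g : DerivedCategory.Q.obj (∐ X) ⟶ Y)
    (hg : ∀ k, DerivedCategory.Q.map (Sigma.ι X k) ≫ g = 0) : g = 0 := by
  obtain ⟨E, e, d, hT⟩ := distinguished_cocone_triangle₁ g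
  choose l hl using fun k => coy2 hT (DerivedCategory.Q.map (Sigma.ι X k)) (hg k)
  obtain ⟨l', hl'⟩ := sigmaQ_desc X E l
  have h1 : IsIso (l' ≫ e) := by
    apply isIso_of_hm
    intro i
    have : ∀ z, hm i (l' ≫ e) z = z := by
      intro z
      obtain ⟨s, x, rfl⟩ := sigmaQ_span X i z
      rw [map_sum]
      refine Finset.sum_congr rfl fun k _ => ?_
      rw [← hm_comp, ← Category.assoc, hl']
      rw [← hl]
    constructor
    · intro a b h; rwa [this, this] at h
    · intro a; exact ⟨a, this a⟩
  rw [← cancel_epi (l' ≫ e), Category.assoc]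
  have : e ≫ g = 0 := comp_distTriang_mor_zero₁₂ _ hT
  rw [this]; simp

lemma coprod_exists (W : ℕ → DR.{w, v} R) : ∃ c : Cofan W, ∃ _ : IsColimit c, ∀ i (z : HH i c.pt),
    ∃ s : Finset ℕ, ∃ x : ∀ k, HH i (W k), z = ∑ k ∈ s, hm i (c.inj k) (x k) := by
  let X : ℕ → Cx.{v} R := fun k => DerivedCategory.Q.objPreimage (W k)
  let e : ∀ k, DerivedCategory.Q.obj (X k) ≅ W k := fun k => DerivedCategory.Q.objObjPreimageIso (W k)
  refine ⟨Cofan.mk (DerivedCategory.Q.obj (∐ X)) (fun k => (e k).inv ≫ DerivedCategory.Q.map (Sigma.ι X k)), ?_, ?_⟩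
  · choose g hg using fun (t : Cofan W) => sigmaQ_desc X t.pt (fun k => (e k).hom ≫ t.inj k)
    refine Cofan.IsColimit.mk _ (fun t => g t) ?_ ?_
    · intro t k
      simp [hg]
    · intro t m hm
      rw [← sub_eq_zero]
      apply sigmaQ_zero X
      intro k
      rw [Preadditive.comp_sub, hg, ← hm k]
      simp
  · intro i z
    obtain ⟨s, x, hx⟩ := sigmaQ_span X i z
    refine ⟨s, fun k => hm i (e k).hom (x k), ?_⟩
    rw [hx]
    refine Finset.sum_congr rfl fun k _ => ?_
    rw [← hm_comp]
    simp

end Nul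

namespace Nul
variable {R : Type} [CommRing R] [HasDerivedCategory.{w} (ModuleCat.{v} R)]

lemma coprod_exists' (W : ℕ → DR.{w, v} R) : ∃ c : Cofan W, ∃ _ : IsColimit c, ∃ pr : ∀ k, c.pt ⟶ W k,
    (∀ k, c.inj k ≫ pr k = 𝟙 _) ∧ (∀ l k, l ≠ k → c.inj l ≫ pr k = 0) ∧ ∀ i (z : HH i c.pt),
    ∃ s : Finset ℕ, z = ∑ k ∈ s, hm i (c.inj k) (hm i (pr k) z) := by
  obtain ⟨c, hc, hs⟩ := coprod_exists W
  let pr : ∀ k, c.pt ⟶ W k := fun k => Cofan.IsColimit.desc hc (fun l => if h : l = k then eqToHom (by rw [h]) else 0)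
  have h1 : ∀ k, c.inj k ≫ pr k = 𝟙 _ := by
    intro k
    simp [pr, Cofan.IsColimit.fac]
  have h2 : ∀ l k, l ≠ k → c.inj l ≫ pr k = 0 := by
    intro l k h
    simp [pr, Cofan.IsColimit.fac, h]
  refine ⟨c, hc, pr, h1, h2, fun i z => ?_⟩
  obtain ⟨s, x, rfl⟩ := hs i z
  refine ⟨s, Finset.sum_congr rfl fun k hk => ?_⟩
  congr 1
  rw [map_sum, Finset.sum_eq_single k]
  · rw [← hm_comp, h1, hm_id]
  · intro l _ hl
    rw [← hm_comp, h2 _ _ hl, hm_zero]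
  · intro h; exact absurd hk h

variable {U : Set (DR.{w, v} R)}

lemma TEL (hU : IsCocompletePreaisle R U) (W : ℕ → DR.{w, v} R) (Y : DR.{w, v} R) (j : ∀ k, W k ⟶ W (k+1))
    (v : ∀ k, W k ⟶ Y) (hjv : ∀ k, j k ≫ v (k+1) = v k) (hW : ∀ k, W k ∈ U)
    (hs : ∀ i (q : HH i Y), ∃ k x, hm i (v k) x = q)
    (hi : ∀ i : ℤ, ∃ K, ∀ k, K ≤ k → ∀ x : HH i (W k), hm i (v k) x = 0 → hm i (j k) x = 0) : Y ∈ U := by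
  obtain ⟨c, hc, pr, p1, p2, hspan⟩ := coprod_exists' W
  have hcU : c.pt ∈ U := hU.coproduct_mem W c hc hW
  let sh : c.pt ⟶ c.pt := Cofan.IsColimit.desc hc (fun k => j k ≫ c.inj (k+1))
  have hsh : ∀ k, c.inj k ≫ sh = j k ≫ c.inj (k+1) := fun k => Cofan.IsColimit.fac hc _ k
  let t : c.pt ⟶ Y := Cofan.IsColimit.desc hc v
  have ht : ∀ k, c.inj k ≫ t = v k := fun k => Cofan.IsColimit.fac hc _ k
  obtain ⟨T, g, h, hT⟩ := distinguished_cocone_triangle (𝟙 c.pt - sh)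
  have hδt : (𝟙 c.pt - sh) ≫ t = 0 := by
    apply Cofan.IsColimit.hom_ext hc
    intro k
    rw [Preadditive.sub_comp, Preadditive.comp_sub, reassoc_of% (hsh k), ht, hjv, Category.id_comp, ht, sub_self, comp_zero]
  obtain ⟨τ, hτ⟩ := yon2 hT t hδt
  have hTU : T ∈ U := hU.ext_mem _ _ _ (rot_of_distTriang _ hT) hcU (hU.shift_mem hcU)
  have hδ : ∀ i (z : HH i c.pt), hm i (𝟙 c.pt - sh) z = z - hm i sh z := by
    intro i z; rw [hm_sub, hm_id]
  have hd0 : (𝟙 c.pt - sh) ≫ pr 0 = pr 0 := by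
    apply Cofan.IsColimit.hom_ext hc
    intro k
    rw [Preadditive.sub_comp, Preadditive.comp_sub, reassoc_of% (hsh k), p2 (k+1) 0 (by simp)]
    simp
  have hd1 : ∀ k, (𝟙 c.pt - sh) ≫ pr (k+1) = pr (k+1) - pr k ≫ j k := by
    intro k
    apply Cofan.IsColimit.hom_ext hc
    intro l
    rw [Preadditive.sub_comp, Preadditive.comp_sub, reassoc_of% (hsh l), Preadditive.comp_sub]
    congr 1
    · simp
    · by_cases hlk : l = k
      · subst hlk
        rw [p1, reassoc_of% (p1 l)]; simp
      · rw [p2 _ _ (by simpa using hlk), reassoc_of% (p2 _ _ hlk)]; simp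
  have hinj : ∀ i (z : HH i c.pt), hm i (𝟙 c.pt - sh) z = 0 → z = 0 := by
    intro i z hz
    have : ∀ k, hm i (pr k) z = 0 := by
      intro k
      induction k with
      | zero => rw [← hd0, hm_comp, hz, map_zero]
      | succ k ih =>
        have := hm_comp i (𝟙 c.pt - sh) (pr (k+1)) z
        rw [hd1, hz, map_zero, hm_sub, hm_comp, ih, map_zero, sub_zero] at this
        exact this
    obtain ⟨s, hs⟩ := hspan i z
    rw [hs]
    exact Finset.sum_eq_zero fun k _ => by rw [this, map_zero]
  have hker : ∀ i (z : HH i c.pt), hm i t z = 0 → ∃ y, hm i (𝟙 c.pt - sh) y = z := by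
    intro i
    set I := LinearMap.range (hm i (𝟙 c.pt - sh)) with hI
    have step : ∀ k (x : HH i (W k)), hm i (c.inj k) x - hm i (c.inj (k+1)) (hm i (j k) x) ∈ I := by
      intro k x
      refine ⟨hm i (c.inj k) x, ?_⟩
      rw [hδ, ← hm_comp, hsh, hm_comp]
    have one : ∀ k (x : HH i (W k)) n, ∃ y, hm i (c.inj k) x - hm i (c.inj (k+n)) y ∈ I := by
      intro k x n
      induction n with
      | zero => exact ⟨x, by
          change hm i (c.inj k) x - hm i (c.inj k) x ∈ I
          rw [sub_self]; exact I.zero_mem⟩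
      | succ n ih =>
        obtain ⟨y, hy⟩ := ih
        refine ⟨hm i (j (k+n)) y, ?_⟩
        have := I.add_mem hy (step (k+n) y)
        rw [sub_add_sub_cancel] at this
        exact this
    have many : ∀ z : HH i c.pt, ∃ M, ∀ m, M ≤ m → ∃ y, z - hm i (c.inj m) y ∈ I := by
      intro z
      obtain ⟨s, hs⟩ := hspan i z
      rw [hs]
      generalize (fun k => hm i (pr k) z) = x
      clear hs
      induction s using Finset.induction_on with
      | empty => exact ⟨0, fun m _ => ⟨0, by simp⟩⟩
      | insert a s ha ih =>
        obtain ⟨M, hM⟩ := ih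
        refine ⟨max M a, fun m hm' => ?_⟩
        obtain ⟨y, hy⟩ := hM m (le_of_max_le_left hm')
        obtain ⟨n, rfl⟩ := Nat.exists_eq_add_of_le (le_of_max_le_right hm')
        obtain ⟨y', hy'⟩ := one a (hm i (pr a) z) n
        refine ⟨y' + y, ?_⟩
        rw [Finset.sum_insert ha, map_add]
        have := I.add_mem hy' hy
        convert this using 1
        abel
    intro z hz
    obtain ⟨M, hM⟩ := many z
    obtain ⟨K, hK⟩ := hi i
    obtain ⟨y, hy⟩ := hM (max M K) (le_max_left _ _)
    have hIt : ∀ a ∈ I, hm i t a = 0 := by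
      rintro _ ⟨b, rfl⟩
      rw [← hm_comp, hδt, hm_zero]
    have h1 := hIt _ hy
    rw [map_sub, hz, zero_sub, neg_eq_zero, ← hm_comp, ht] at h1
    have h2 := hK _ (le_max_right _ _) y h1
    have h3 := step _ y
    rw [h2, map_zero, sub_zero] at h3
    have := I.add_mem hy h3
    rw [sub_add_cancel] at this
    exact this
  have : IsIso τ := by
    apply isIso_of_hm
    intro i
    constructor
    · rw [injective_iff_map_eq_zero]
      intro z hz
      obtain ⟨d, d1, d2, d3, d4⟩ := hm_exact3 _ _ _ hT i
      obtain ⟨y, rfl⟩ := d3 z (hinj _ _ (d2 z))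
      rw [← hm_comp, ← hτ] at hz
      obtain ⟨y', rfl⟩ := hker i y hz
      exact hm_comp_zero _ _ _ hT i y'
    · intro q
      obtain ⟨k, x, rfl⟩ := hs i q
      exact ⟨hm i g (hm i (c.inj k) x), by rw [← hm_comp, ← hm_comp, ← hτ, ht]⟩
  exact hU.mem_of_iso (asIso τ) hTU

lemma mem_retract (hU : IsCocompletePreaisle R U) {D X : DR.{w, v} R} (s : D ⟶ X) (r : X ⟶ D) (h : s ≫ r = 𝟙 D)
    (hX : X ∈ U) : D ∈ U := by
  refine TEL hU (fun _ => X) D (fun _ => r ≫ s) (fun _ => r) (fun _ => by simp [h]) (fun _ => hX) ?_ ?_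
  · intro i q
    exact ⟨0, hm i s q, by rw [← hm_comp, h, hm_id]⟩
  · intro i
    exact ⟨0, fun k _ x hx => by rw [hm_comp, hx, map_zero]⟩

lemma mem_zero (hU : IsCocompletePreaisle R U) {D : DR.{w, v} R} (hD : IsZero D) : D ∈ U := by
  let c : Cofan (fun (_ : Empty) => D) := Cofan.mk D (fun e => e.elim)
  refine hU.coproduct_mem (fun (_ : Empty) => D) c ?_ (fun e => e.elim)
  exact Cofan.IsColimit.mk _ (fun t => 0) (fun t e => e.elim) (fun t m _ => hD.eq_of_src _ _)

lemma mem_ext' (hU : IsCocompletePreaisle R U) (T : Triangle (DR.{w, v} R)) (hT : T ∈ distTriang _)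
    (h1 : T.obj₁ ∈ U) (h3 : T.obj₃ ∈ U) : T.obj₂ ∈ U :=
  hU.ext_mem T.mor₁ T.mor₂ T.mor₃ hT h1 h3

lemma mem_shift (hU : IsCocompletePreaisle R U) {X : DR.{w, v} R} (n : ℕ) (hX : X ∈ U) : X⟦(n : ℤ)⟧ ∈ U := by
  induction n with
  | zero => exact hU.mem_of_iso ((shiftFunctorZero' (DR.{w, v} R) ((0 : ℕ) : ℤ) (by simp)).symm.app X) hX
  | succ n ih =>
    exact hU.mem_of_iso ((shiftFunctorAdd' (DR.{w, v} R) (n : ℤ) 1 ((n+1 : ℕ) : ℤ) (by simp)).symm.app X) (hU.shift_mem ih)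

end Nul

namespace Nul
variable {R : Type} [CommRing R] [HasDerivedCategory.{w} (ModuleCat.{v} R)] {U : Set (DR.{w, v} R)}

lemma mem_of_shift_tri (hU : IsCocompletePreaisle R U) {X Y Z : DR.{w, v} R}
    (f : X⟦(1 : ℤ)⟧ ⟶ Y⟦(1 : ℤ)⟧) (g : Y⟦(1 : ℤ)⟧ ⟶ Z⟦(1 : ℤ)⟧) (h : Z⟦(1 : ℤ)⟧ ⟶ X⟦(1 : ℤ)⟧⟦(1 : ℤ)⟧)
    (hT : Triangle.mk f g h ∈ distTriang _) (hX : X ∈ U) (hZ : Z ∈ U) : Y ∈ U := by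
  have h1 := Triangle.shift_distinguished _ hT (-1)
  have e : ∀ A : DR.{w, v} R, A⟦(1 : ℤ)⟧⟦(-1 : ℤ)⟧ ≅ A := fun A => shiftShiftNeg A 1
  have := mem_ext' hU _ h1 (hU.mem_of_iso (e X).symm hX) (hU.mem_of_iso (e Z).symm hZ)
  exact hU.mem_of_iso (e Y) this

lemma fiber_step (hU : IsCocompletePreaisle R U) {W Y0 Y V Y' : DR.{w, v} R}
    (a : W ⟶ Y0) (c : Y0 ⟶ Y) (h : Y ⟶ W⟦(1 : ℤ)⟧) (hT : Triangle.mk a c h ∈ distTriang _)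
    (b : V ⟶ Y) (d : Y ⟶ Y') (h' : Y' ⟶ V⟦(1 : ℤ)⟧) (hT' : Triangle.mk b d h' ∈ distTriang _)
    (hW : W ∈ U) (hV : V ∈ U) :
    ∃ (W' : DR.{w, v} R) (_ : W' ∈ U) (a' : W' ⟶ Y0) (c' : Y0 ⟶ Y') (h'' : Y' ⟶ W'⟦(1 : ℤ)⟧)
      (_ : Triangle.mk a' c' h'' ∈ distTriang _) (j : W ⟶ W'), j ≫ a' = a := by
  obtain ⟨W', a', h'', hT''⟩ := distinguished_cocone_triangle₁ (c ≫ d)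
  have oct := Triangulated.someOctahedron (rfl : c ≫ d = c ≫ d) (rot_of_distTriang _ hT)
    (rot_of_distTriang _ hT') (rot_of_distTriang _ hT'')
  have hW' : W' ∈ U := mem_of_shift_tri hU _ _ _ oct.mem hW hV
  obtain ⟨j, hj, _⟩ := complete_distinguished_triangle_morphism₁ _ _ hT hT'' (𝟙 Y0) d
    (Category.id_comp (c ≫ d)).symm
  exact ⟨W', hW', a', c ≫ d, h'', hT'', j, hj.symm.trans (Category.comp_id a)⟩

structure Stage (U : Set (DR.{w, v} R)) (P : ℕ → Set (DR.{w, v} R)) (Y0 : DR.{w, v} R) (k : ℕ) where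
  W : DR.{w, v} R
  Y : DR.{w, v} R
  a : W ⟶ Y0
  c : Y0 ⟶ Y
  h : Y ⟶ W⟦(1 : ℤ)⟧
  hT : Triangle.mk a c h ∈ distTriang _
  hW : W ∈ U
  hY : Y ∈ P k

lemma tower (hU : IsCocompletePreaisle R U) (P : ℕ → Set (DR.{w, v} R)) (b : ℤ)
    (hle : ∀ k, ∀ Y ∈ P k, ∀ i : ℤ, b - k < i → ∀ x : HH i Y, x = 0)
    (hstep : ∀ k, ∀ Y ∈ P k, ∃ V ∈ U, ∃ Y' ∈ P (k+1), ∃ (f : V ⟶ Y) (g : Y ⟶ Y') (h : Y' ⟶ V⟦(1 : ℤ)⟧),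
      Triangle.mk f g h ∈ distTriang _) (Y : DR.{w, v} R) (hY : Y ∈ P 0) : Y ∈ U := by
  have nxt : ∀ k (S : Stage U P Y k), ∃ S' : Stage U P Y (k+1), ∃ j : S.W ⟶ S'.W, j ≫ S'.a = S.a := by
    intro k S
    obtain ⟨V, hV, Y', hY', f, g, h, hT⟩ := hstep k S.Y S.hY
    obtain ⟨W', hW', a', c', h'', hT'', j, hj⟩ := fiber_step hU S.a S.c S.h S.hT f g h hT S.hW hV
    exact ⟨⟨W', Y', a', c', h'', hT'', hW', hY'⟩, j, hj⟩
  choose nx j hj using nxt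
  have z0 : ∃ S : Stage U P Y 0, True := by
    obtain ⟨W', a', h'', hT''⟩ := distinguished_cocone_triangle₁ (𝟙 Y)
    have : IsZero W' := by
      apply Triangle.isZero₁_of_isIso₂ _ hT''
      exact inferInstanceAs (IsIso (𝟙 Y))
    exact ⟨⟨W', Y, a', 𝟙 Y, h'', hT'', mem_zero hU this, hY⟩, trivial⟩
  obtain ⟨S0, -⟩ := z0
  let S : ∀ k, Stage U P Y k := fun k => Nat.rec S0 (fun k s => nx k s) k
  refine TEL hU (fun k => (S k).W) Y (fun k => j k (S k)) (fun k => (S k).a) (fun k => hj k (S k)) (fun k => (S k).hW) ?_ ?_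
  · intro i q
    let k : ℕ := (b - i + 1).toNat
    obtain ⟨x, hx⟩ := hm_exact2 _ _ _ (S k).hT i q (hle k _ (S k).hY i (by omega) _)
    exact ⟨k, x, hx⟩
  · intro i
    refine ⟨(b - i + 2).toNat, fun k hk x hx => ?_⟩
    have : x = 0 := by
      obtain ⟨i, rfl⟩ : ∃ i', i = i' + 1 := ⟨i - 1, by ring⟩
      obtain ⟨d, d1, d2, d3, d4⟩ := hm_exact3 _ _ _ (S k).hT i
      obtain ⟨z, rfl⟩ := d4 x hx
      rw [hle k _ (S k).hY i (by omega) z, map_zero]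
    rw [this, map_zero]

end Nul

namespace Nul
variable {R : Type} [CommRing R]

noncomputable def tenC (L : Type) [AddCommGroup L] [Module R L] (P : Cx.{v} R) : Cx.{v} R where
  X i := ModuleCat.of R (L ⊗[R] P.X i)
  d i j := ModuleCat.ofHom (LinearMap.lTensor L (P.d i j).hom)
  shape i j h := by
    rw [P.shape i j h, ModuleCat.hom_zero, LinearMap.lTensor_zero]; rfl
  d_comp_d' i j k _ _ := by
    rw [← ModuleCat.ofHom_comp, ← LinearMap.lTensor_comp, ← ModuleCat.hom_comp, P.d_comp_d,
      ModuleCat.hom_zero, LinearMap.lTensor_zero]; rfl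

noncomputable def tenMap {L L' : Type} [AddCommGroup L] [Module R L] [AddCommGroup L'] [Module R L'] (f : L →ₗ[R] L')
    (P : Cx.{v} R) : tenC L P ⟶ tenC L' P where
  f i := ModuleCat.ofHom (LinearMap.rTensor (P.X i) f)
  comm' i j _ := by
    change ModuleCat.ofHom (LinearMap.rTensor (P.X i) f) ≫ ModuleCat.ofHom (LinearMap.lTensor L' (P.d i j).hom)
      = ModuleCat.ofHom (LinearMap.lTensor L (P.d i j).hom) ≫ ModuleCat.ofHom (LinearMap.rTensor (P.X j) f)
    rw [← ModuleCat.ofHom_comp, ← ModuleCat.ofHom_comp, LinearMap.lTensor_comp_rTensor,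
      LinearMap.rTensor_comp_lTensor]

noncomputable def tenFun (L : Type) [AddCommGroup L] [Module R L] {P P' : Cx.{v} R} (f : P ⟶ P') :
    tenC L P ⟶ tenC L P' where
  f i := ModuleCat.ofHom (LinearMap.lTensor L (f.f i).hom)
  comm' i j _ := by
    change ModuleCat.ofHom (LinearMap.lTensor L (f.f i).hom) ≫ ModuleCat.ofHom (LinearMap.lTensor L (P'.d i j).hom)
      = ModuleCat.ofHom (LinearMap.lTensor L (P.d i j).hom) ≫ ModuleCat.ofHom (LinearMap.lTensor L (f.f j).hom)
    rw [← ModuleCat.ofHom_comp, ← ModuleCat.ofHom_comp, ← LinearMap.lTensor_comp, ← LinearMap.lTensor_comp,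
      ← ModuleCat.hom_comp, ← ModuleCat.hom_comp, f.comm]

lemma tenC_ses {L1 L2 L3 : Type} [AddCommGroup L1] [Module R L1] [AddCommGroup L2] [Module R L2]
    [AddCommGroup L3] [Module R L3] (f : L1 →ₗ[R] L2) (g : L2 →ₗ[R] L3) (hf : Function.Injective f)
    (hg : Function.Surjective g) (hfg : Function.Exact f g) (P : Cx.{v} R) (hP : ∀ i, Module.Flat R (P.X i)) :
    ∃ h : tenMap f P ≫ tenMap g P = 0, (ShortComplex.mk _ _ h).ShortExact := by
  have h : tenMap f P ≫ tenMap g P = 0 := by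
    ext i : 1
    change ModuleCat.ofHom (LinearMap.rTensor (P.X i) f) ≫ ModuleCat.ofHom (LinearMap.rTensor (P.X i) g) = 0
    rw [← ModuleCat.ofHom_comp, ← LinearMap.rTensor_comp, hfg.linearMap_comp_eq_zero, LinearMap.rTensor_zero]; rfl
  refine ⟨h, HomologicalComplex.shortExact_of_degreewise_shortExact _ fun i => ?_⟩
  have := hP i
  refine ShortComplex.ShortExact.mk' ?_ ?_ ?_
  · rw [ShortComplex.moduleCat_exact_iff]
    intro x hx
    exact (rTensor_exact (P.X i) hfg hg x).1 hx
  · rw [ModuleCat.mono_iff_injective]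
    exact Module.Flat.rTensor_preserves_injective_linearMap f hf
  · rw [ModuleCat.epi_iff_surjective]
    exact LinearMap.rTensor_surjective (P.X i) hg

variable [HasDerivedCategory.{w} (ModuleCat.{v} R)] {U : Set (DR.{w, v} R)}

noncomputable abbrev QQ (K : Cx.{v} R) : DR.{w, v} R := DerivedCategory.Q.obj K

lemma tri_of_ses (S : ShortComplex (Cx.{v} R)) (hS : S.ShortExact) :
    ∃ h : QQ.{w} S.X₃ ⟶ (QQ.{w} S.X₁)⟦(1 : ℤ)⟧, Triangle.mk (DerivedCategory.Q.map S.f) (DerivedCategory.Q.map S.g) h ∈ distTriang _ :=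
  ⟨_, DerivedCategory.triangleOfSES_distinguished hS⟩

lemma tenC_tri {L1 L2 L3 : Type} [AddCommGroup L1] [Module R L1] [AddCommGroup L2] [Module R L2]
    [AddCommGroup L3] [Module R L3] (f : L1 →ₗ[R] L2) (g : L2 →ₗ[R] L3) (hf : Function.Injective f)
    (hg : Function.Surjective g) (hfg : Function.Exact f g) (P : Cx.{v} R) (hP : ∀ i, Module.Flat R (P.X i)) :
    ∃ (a : QQ.{w} (tenC L1 P) ⟶ QQ.{w} (tenC L2 P)) (b : QQ.{w} (tenC L2 P) ⟶ QQ.{w} (tenC L3 P))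
     (h : QQ.{w} (tenC L3 P) ⟶ (QQ.{w} (tenC L1 P))⟦(1 : ℤ)⟧), Triangle.mk a b h ∈ distTriang _ := by
  obtain ⟨h, hS⟩ := tenC_ses f g hf hg hfg P hP
  obtain ⟨h, hT⟩ := tri_of_ses.{w} _ hS
  exact ⟨_, _, h, hT⟩

noncomputable def tenC_one (P : Cx.{v} R) : tenC R P ≅ P :=
  HomologicalComplex.Hom.isoOfComponents (fun i => (TensorProduct.lid R (P.X i)).toModuleIso) (by
    intro i j _
    change ModuleCat.ofHom (TensorProduct.lid R (P.X i)).toLinearMap ≫ P.d i j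
      = ModuleCat.ofHom (LinearMap.lTensor R (P.d i j).hom) ≫ ModuleCat.ofHom (TensorProduct.lid R (P.X j)).toLinearMap
    ext : 1
    apply TensorProduct.ext'
    intro a b
    change (P.d i j).hom (a • b) = a • (P.d i j).hom b
    simp)

lemma tenC_free_mem (hU : IsCocompletePreaisle R U) (P : Cx.{v} R) (hP : ∀ i, Module.Flat R (P.X i))
    (hPU : QQ.{w} P ∈ U) (n : ℕ) : QQ.{w} (tenC (Fin n → R) P) ∈ U := by
  induction n with
  | zero =>
    apply mem_zero hU
    apply (DerivedCategory.Q (C := ModuleCat.{v} R)).map_isZero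
    rw [IsZero.iff_id_eq_zero]
    ext i x
    change x = 0
    have : Subsingleton ((Fin 0 → R) ⊗[R] P.X i) := inferInstance
    exact @Subsingleton.elim ((Fin 0 → R) ⊗[R] P.X i) _ x 0
  | succ n ih =>
    let f : R →ₗ[R] (Fin (n+1) → R) := LinearMap.single R (fun _ => R) 0
    let g : (Fin (n+1) → R) →ₗ[R] (Fin n → R) := LinearMap.funLeft R R Fin.succ
    obtain ⟨a, b, h, hT⟩ := tenC_tri.{w} f g (Pi.single_injective (M := fun _ => R) 0) (by
      intro x
      exact ⟨Fin.cons 0 x, by ext i; simp [g, LinearMap.funLeft]⟩) (by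
      intro x
      constructor
      · intro hx
        refine ⟨x 0, ?_⟩
        ext i
        refine Fin.cases ?_ (fun i => ?_) i
        · simp [f]
        · have := congrFun hx i
          simp [g, LinearMap.funLeft] at this
          simp [f, this]
      · rintro ⟨y, rfl⟩
        ext i
        simp [f, g, LinearMap.funLeft]) P hP
    exact hU.ext_mem _ _ _ hT (hU.mem_of_iso (DerivedCategory.Q.mapIso (tenC_one P).symm) hPU) ih

lemma HH_shift_zero (X : DR.{w, v} R) (k i : ℤ) (h : ∀ x : HH (i + k) X, x = 0) (x : HH i (X⟦k⟧)) : x = 0 := by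
  let e : HH i (X⟦k⟧) ≅ HH (i+k) X :=
    ((DerivedCategory.homologyFunctor (ModuleCat.{v} R) 0).shiftIso k i (i+k) (by ring)).app X
  have : e.hom x = e.hom 0 := by rw [h (e.hom x), h (e.hom 0)]
  exact (ConcreteCategory.bijective_of_isIso e.hom).1 this

lemma HH_QQ_zero (K : Cx.{v} R) (i : ℤ) (h : IsZero (K.X i)) (x : HH i (QQ.{w} K)) : x = 0 := by
  have hz : IsZero (K.homology i) := ShortComplex.isZero_homology_of_isZero_X₂ _ h
  have h2 : IsZero (HH i (QQ.{w} K)) := hz.of_iso ((DerivedCategory.homologyFunctorFactors _ i).app K)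
  have := ModuleCat.subsingleton_of_isZero h2
  exact Subsingleton.elim _ _

lemma dist_iso {X Y Z X' Y' Z' : DR.{w, v} R} {f : X ⟶ Y} {g : Y ⟶ Z} {h : Z ⟶ X⟦(1 : ℤ)⟧}
    (hT : Triangle.mk f g h ∈ distTriang _) (f' : X' ⟶ Y') (g' : Y' ⟶ Z') (h' : Z' ⟶ X'⟦(1 : ℤ)⟧)
    (eX : X ≅ X') (eY : Y ≅ Y') (eZ : Z ≅ Z') (c1 : f ≫ eY.hom = eX.hom ≫ f') (c2 : g ≫ eZ.hom = eY.hom ≫ g')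
    (c3 : h ≫ eX.hom⟦(1 : ℤ)⟧' = eZ.hom ≫ h') : Triangle.mk f' g' h' ∈ distTriang _ :=
  isomorphic_distinguished _ hT _ (Triangle.isoMk (Triangle.mk f g h) (Triangle.mk f' g' h') eX eY eZ c1 c2 c3).symm

lemma tri_replace (T : Triangle (DR.{w, v} R)) (hT : T ∈ distTriang _) {Y : DR.{w, v} R} (e : Y ≅ T.obj₂) :
    ∃ (f : T.obj₁ ⟶ Y) (g : Y ⟶ T.obj₃) (h : T.obj₃ ⟶ T.obj₁⟦(1 : ℤ)⟧), Triangle.mk f g h ∈ distTriang _ := by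
  refine ⟨T.mor₁ ≫ e.inv, e.hom ≫ T.mor₂, T.mor₃, ?_⟩
  have hT' : Triangle.mk T.mor₁ T.mor₂ T.mor₃ ∈ distTriang _ := hT
  exact dist_iso hT' _ _ _ (Iso.refl _) e.symm (Iso.refl _) (by simp) (by simp) (by simp)

lemma tenC_mem [IsNoetherianRing R] (hU : IsCocompletePreaisle R U) (P : Cx.{v} R) (hP : ∀ i, Module.Flat R (P.X i))
    (b : ℤ) (hb : ∀ i, b < i → IsZero (P.X i))
    (hPU : QQ.{w} P ∈ U) (L : Type) [AddCommGroup L] [Module R L] [Module.Finite R L] : QQ.{w} (tenC L P) ∈ U := by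
  refine tower hU (fun k => {Y | ∃ (L : Type) (_ : AddCommGroup L) (_ : Module R L) (_ : Module.Finite R L),
    Nonempty (Y ≅ (QQ.{w} (tenC L P))⟦(k : ℤ)⟧)}) b ?_ ?_ _ ?_
  · rintro k Y ⟨L, _, _, _, ⟨e⟩⟩ i hi x
    have h1 : hm i e.hom x = 0 := by
      apply HH_shift_zero
      apply HH_QQ_zero
      have : Subsingleton (P.X (i + k)) := ModuleCat.subsingleton_of_isZero (hb _ (by omega))
      have h3 : Subsingleton (L ⊗[R] (P.X (i+k))) := inferInstance
      exact @ModuleCat.isZero_of_subsingleton R _ (ModuleCat.of R (L ⊗[R] (P.X (i+k)))) h3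
    have h2 : hm i e.inv (hm i e.hom x) = x := by rw [← hm_comp, e.hom_inv_id, hm_id]
    rw [← h2, h1, map_zero]
  · rintro k Y ⟨L, _, _, _, ⟨e⟩⟩
    obtain ⟨n, g, hg⟩ := Module.Finite.exists_fin' R L
    obtain ⟨a, b, h, hT⟩ := tenC_tri.{w} (LinearMap.ker g).subtype g (Submodule.subtype_injective _) hg
      (LinearMap.exact_subtype_ker_map g) P hP
    have h1 := Triangle.shift_distinguished _ (rot_of_distTriang _ hT) k
    refine ⟨(QQ.{w} (tenC (Fin n → R) P))⟦(k : ℤ)⟧, mem_shift hU k (tenC_free_mem hU P hP hPU n), 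
      (QQ.{w} (tenC (LinearMap.ker g) P))⟦(1 : ℤ)⟧⟦(k : ℤ)⟧,
      ⟨LinearMap.ker g, inferInstance, inferInstance, inferInstance,
        ⟨(shiftFunctorAdd' (DR.{w, v} R) 1 (k : ℤ) ((k+1 : ℕ) : ℤ) (by simp [add_comm])).symm.app _⟩⟩, ?_⟩
    exact tri_replace _ h1 e
  · exact ⟨L, inferInstance, inferInstance, inferInstance, ⟨(shiftFunctorZero' (DR.{w, v} R) ((0 : ℕ) : ℤ) (by simp)).symm.app _⟩⟩

end Nul

namespace Nul
variable {R : Type} [CommRing R]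

noncomputable abbrev sC (i : ℤ) : ModuleCat.{v} R ⥤ Cx.{v} R :=
  HomologicalComplex.single (ModuleCat.{v} R) (ComplexShape.up ℤ) i

variable [HasDerivedCategory.{w} (ModuleCat.{v} R)] {U : Set (DR.{w, v} R)}

noncomputable abbrev sF (i : ℤ) : ModuleCat.{v} R ⥤ DR.{w, v} R :=
  DerivedCategory.singleFunctor (ModuleCat.{v} R) i

noncomputable abbrev sg (i : ℤ) (M : ModuleCat.{v} R) : DR.{w, v} R := (sF i).obj M

lemma sg_tri (i : ℤ) (S : ShortComplex (ModuleCat.{v} R)) (hS : S.ShortExact) :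
    ∃ h : sg.{w} i S.X₃ ⟶ (sg i S.X₁)⟦(1 : ℤ)⟧, Triangle.mk ((sF i).map S.f) ((sF i).map S.g) h ∈ distTriang _ :=
  tri_of_ses.{w} _ (hS.map_of_exact (sC i))

noncomputable def sg_shift (i n j : ℤ) (h : n + j = i) (M : ModuleCat.{v} R) : (sg.{w} i M)⟦n⟧ ≅ sg j M :=
  ((DerivedCategory.singleFunctors (ModuleCat.{v} R)).shiftIso n j i h).app M

noncomputable def HH_sg (i : ℤ) (M : ModuleCat.{v} R) : HH i (sg.{w} i M) ≅ M :=
  (DerivedCategory.singleFunctorCompHomologyFunctorIso (ModuleCat.{v} R) i).app M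

abbrev Rq (q : Ideal R) : ModuleCat.{v} R := ModuleCat.of R (ULift.{v} (R ⧸ q))

lemma single_mem [IsNoetherianRing R] (hU : IsCocompletePreaisle R U) (i : ℤ) (L : Type v) [AddCommGroup L] [Module R L]
    [hL : Module.Finite R L] (h : ∀ q ∈ Module.support R L, sg i (Rq q.asIdeal) ∈ U) :
    sg i (ModuleCat.of R L) ∈ U := by
  revert h
  refine IsNoetherianRing.induction_on_isQuotientEquivQuotientPrime R hL
    (motive := fun N _ _ _ => (∀ q ∈ Module.support R N, sg i (Rq q.asIdeal) ∈ U) → sg i (ModuleCat.of R N) ∈ U) ?_ ?_ ?_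
  · intro N _ _ _ _ _
    apply mem_zero hU
    apply (sF i).map_isZero
    exact ModuleCat.isZero_of_subsingleton _
  · intro N _ _ _ p e h
    have := h p (by
      rw [e.support_eq, Module.mem_support_iff_of_finite, Ideal.annihilator_quotient])
    exact hU.mem_of_iso ((sF i).mapIso (e.trans ULift.moduleEquiv.symm).toModuleIso.symm) this
  · intro N1 _ _ _ N2 _ _ _ N3 _ _ _ f g hf hg hfg h1 h3 h
    rw [Module.support_of_exact hfg hf hg] at h
    let S : ShortComplex (ModuleCat.{v} R) := ShortComplex.mk (ModuleCat.ofHom f) (ModuleCat.ofHom g) (by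
      rw [← ModuleCat.ofHom_comp, hfg.linearMap_comp_eq_zero]; rfl)
    have hS : S.ShortExact := by
      refine ShortComplex.ShortExact.mk' ?_ ?_ ?_
      · rw [ShortComplex.moduleCat_exact_iff]
        intro x hx
        exact (hfg x).1 hx
      · rw [ModuleCat.mono_iff_injective]
        exact hf
      · rw [ModuleCat.epi_iff_surjective]
        exact hg
    obtain ⟨d, hd⟩ := sg_tri.{w} i S hS
    exact hU.ext_mem _ _ _ hd (h1 fun q hq => h q (Or.inl hq)) (h3 fun q hq => h q (Or.inr hq))

lemma trunc (M : DR.{w, v} R) (m : ℤ) : ∃ (A B : DR.{w, v} R) (f : A ⟶ M) (g : M ⟶ B) (h : B ⟶ A⟦(1 : ℤ)⟧),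
    Triangle.mk f g h ∈ distTriang _ ∧ A.IsLE (m - 1) ∧ B.IsGE m ∧
    (∀ i, m ≤ i → ∀ x : HH i A, x = 0) ∧ (∀ i, i < m → ∀ x : HH i B, x = 0) ∧
    (∀ i, i < m → Function.Bijective (hm i f)) ∧ (∀ i, m ≤ i → Function.Bijective (hm i g)) := by
  let t := DerivedCategory.TStructure.t (C := ModuleCat.{v} R)
  have hT := t.triangleLTGE_distinguished m M
  set T := (t.triangleLTGE m).obj M with hTdef
  have hA : T.obj₁.IsLE (m - 1) := by
    exact t.isLE_truncLT_obj M m (m-1) (by omega)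
  have hB : T.obj₃.IsGE m := by
    exact t.isGE_truncGE_obj M m m (by omega)
  have hA' : ∀ i, m ≤ i → ∀ x : HH i T.obj₁, x = 0 := by
    intro i hi x
    have := ModuleCat.subsingleton_of_isZero ((DerivedCategory.isLE_iff _ _).1 hA i (by omega))
    exact Subsingleton.elim _ _
  have hB' : ∀ i, i < m → ∀ x : HH i T.obj₃, x = 0 := by
    intro i hi x
    have := ModuleCat.subsingleton_of_isZero ((DerivedCategory.isGE_iff _ _).1 hB i (by omega))
    exact Subsingleton.elim _ _
  have hT' : Triangle.mk T.mor₁ T.mor₂ T.mor₃ ∈ distTriang _ := hT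
  refine ⟨T.obj₁, T.obj₃, T.mor₁, T.mor₂, T.mor₃, hT, hA, hB, hA', hB', ?_, ?_⟩
  · intro i hi
    constructor
    · rw [injective_iff_map_eq_zero]
      intro x hx
      obtain ⟨i, rfl⟩ : ∃ i', i = i' + 1 := ⟨i - 1, by ring⟩
      obtain ⟨d, d1, d2, d3, d4⟩ := hm_exact3 _ _ _ hT' i
      obtain ⟨z, rfl⟩ := d4 x hx
      rw [hB' i (by omega) z, map_zero]
    · intro y
      exact hm_exact2 _ _ _ hT' i y (hB' i hi _)
  · intro i hi
    constructor
    · rw [injective_iff_map_eq_zero]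
      intro x hx
      obtain ⟨z, rfl⟩ := hm_exact2 _ _ _ hT' i x hx
      rw [hA' i (by omega) z]; exact map_zero _
    · intro y
      obtain ⟨d, d1, d2, d3, d4⟩ := hm_exact3 _ _ _ hT' i
      exact d3 y (hA' (i+1) (by omega) _)

noncomputable def isoOfBij {X Y : ModuleCat.{v} R} (f : X →ₗ[R] Y) (h : Function.Bijective f) : X ≅ Y :=
  (LinearEquiv.ofBijective f h).toModuleIso

lemma dev (Pr : DR.{w, v} R → Prop) (hiso : ∀ X Y : DR.{w, v} R, (X ≅ Y) → Pr X → Pr Y) 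
    (hzero : ∀ X : DR.{w, v} R, IsZero X → Pr X)
    (hext : ∀ (X Y Z : DR.{w, v} R) (f : X ⟶ Y) (g : Y ⟶ Z) (h : Z ⟶ X⟦(1 : ℤ)⟧),
      (Triangle.mk f g h ∈ distTriang _) → Pr X → Pr Z → Pr Y)
    (M : DR.{w, v} R) (a b : ℤ) (ha : ∀ i, i < a → ∀ x : HH i M, x = 0) (hb : ∀ i, b < i → ∀ x : HH i M, x = 0)
    (hs : ∀ i, Pr (sg i (HH i M))) : Pr M := by
  obtain ⟨n, hn⟩ : ∃ n : ℕ, b < a + n := ⟨(b - a + 1).toNat, by omega⟩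
  replace hb : ∀ i, a + n ≤ i → ∀ x : HH i M, x = 0 := fun i hi => hb i (by omega)
  clear hn
  induction n generalizing M with
  | zero =>
    apply hzero
    rw [IsZero.iff_id_eq_zero]
    have : IsIso (0 : M ⟶ M) := by
      apply isIso_of_hm
      intro i
      have : ∀ x : HH i M, x = 0 := by
        intro x
        rcases lt_or_ge i a with h | h
        · exact ha i h x
        · exact hb i (by simpa using h) x
      constructor
      · intro x y _; rw [this x, this y]
      · intro y; exact ⟨0, by rw [this y, map_zero]⟩
    rw [← cancel_epi (0 : M ⟶ M)]; simp
  | succ n ih =>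
    obtain ⟨A, B, f, g, h, hT, hA, hB, hA', hB', hf, hg⟩ := trunc M (a + n)
    have hBle : B.IsLE (a + n) := by
      rw [DerivedCategory.isLE_iff]
      intro i hi
      have : Subsingleton (HH i B) := by
        refine ⟨fun x y => ?_⟩
        obtain ⟨x, rfl⟩ := (hg i (by omega)).2 x
        obtain ⟨y, rfl⟩ := (hg i (by omega)).2 y
        rw [hb i (by push_cast; omega) x, hb i (by push_cast; omega) y]
      exact ModuleCat.isZero_of_subsingleton _
    refine hext A M B f g h hT ?_ ?_
    · apply ih
      · intro i hi x
        apply (hf i (by omega)).1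
        rw [ha i hi (hm i f x), map_zero]
      · intro i
        rcases lt_or_ge i (a + n) with h | h
        · exact hiso _ _ ((sF i).mapIso (isoOfBij _ (hf i h)).symm) (hs i)
        · apply hzero
          apply (sF i).map_isZero
          have : Subsingleton (HH i A) := ⟨fun x y => by rw [hA' i h x, hA' i h y]⟩
          exact ModuleCat.isZero_of_subsingleton _
      · exact hA'
    · obtain ⟨Y, ⟨e⟩⟩ := DerivedCategory.exists_iso_singleFunctor_obj_of_isGE_of_isLE B (a + n)
      refine hiso _ _ ?_ (hs (a + n))
      refine (sF (a+n)).mapIso ?_ ≪≫ e.symm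
      exact isoOfBij _ (hg _ le_rfl) ≪≫ (DerivedCategory.homologyFunctor _ (a+n)).mapIso e ≪≫ HH_sg _ Y

lemma bounded_mem [IsNoetherianRing R] (hU : IsCocompletePreaisle R U) (M : DR.{w, v} R) (a b : ℤ)
    (ha : ∀ i, i < a → ∀ x : HH i M, x = 0) (hb : ∀ i, b < i → ∀ x : HH i M, x = 0)
    (hfin : ∀ i, Module.Finite R (HH i M))
    (h : ∀ i, ∀ q ∈ Module.support R (HH i M), sg i (Rq q.asIdeal) ∈ U) : M ∈ U := by
  refine dev (fun X => X ∈ U) (fun X Y e => hU.mem_of_iso e) (fun X => mem_zero hU) 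
    (fun X Y Z f g h hT => hU.ext_mem f g h hT) M a b ha hb ?_
  intro i
  have := hfin i
  exact single_mem hU i (HH i M) (h i)

end Nul

namespace Nul
variable {R : Type} [CommRing R] [HasDerivedCategory.{w} (ModuleCat.{v} R)] {U : Set (DR.{w, v} R)}

lemma kp_lift (P K : Cx.{v} R) [P.IsKProjective] (φ : QQ.{w} P ⟶ QQ.{w} K) : 
    ∃ f : P ⟶ K, DerivedCategory.Q.map f = φ := by
  obtain ⟨g, hg⟩ := (CochainComplex.IsKProjective.Qh_map_bijective P ((HomotopyCategory.quotient _ _).obj K)).surjective 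
    ((DerivedCategory.quotientCompQhIso _).hom.app P ≫ φ ≫ (DerivedCategory.quotientCompQhIso _).inv.app K)
  obtain ⟨f, rfl⟩ := (HomotopyCategory.quotient _ _).map_surjective g
  refine ⟨f, ?_⟩
  have := (DerivedCategory.quotientCompQhIso (ModuleCat.{v} R)).hom.naturality f
  rw [← cancel_epi ((DerivedCategory.quotientCompQhIso _).hom.app P), ← this]
  erw [hg]
  simp

def PB (X : DR.{w, v} R) : Prop := ∃ P : Cx.{v} R, (∀ i, Projective (P.X i)) ∧ (∃ b : ℤ, ∀ i, b < i → IsZero (P.X i)) ∧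
  Nonempty (X ≅ QQ.{w} P)

lemma kp_of (P : Cx.{v} R) (h : ∀ i, Projective (P.X i)) (b : ℤ) (hb : ∀ i, b < i → IsZero (P.X i)) : P.IsKProjective := by
  have : P.IsStrictlyLE b := (CochainComplex.isStrictlyLE_iff _ _).2 hb
  exact CochainComplex.isKProjective_of_projective P b

lemma PB_iso {X Y : DR.{w, v} R} (e : X ≅ Y) (h : PB X) : PB Y := by
  obtain ⟨P, h1, h2, ⟨e'⟩⟩ := h
  exact ⟨P, h1, h2, ⟨e.symm ≪≫ e'⟩⟩

lemma PB_shift {X : DR.{w, v} R} (n : ℤ) (h : PB X) : PB (X⟦n⟧) := by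
  obtain ⟨P, h1, ⟨b, hb⟩, ⟨e'⟩⟩ := h
  refine ⟨P⟦n⟧, fun i => h1 (i + n), ⟨b - n, fun i hi => hb (i + n) (by omega)⟩, ⟨?_⟩⟩
  exact (shiftFunctor _ n).mapIso e' ≪≫ ((DerivedCategory.Q.commShiftIso n).app P).symm

lemma PB_ext (X Y Z : DR.{w, v} R) (f : X ⟶ Y) (g : Y ⟶ Z) (h : Z ⟶ X⟦(1 : ℤ)⟧)
      (hT : Triangle.mk f g h ∈ distTriang _) (hX : PB X) (hZ : PB Z) : PB Y := by
  obtain ⟨P, h1, ⟨b, hb⟩, ⟨e⟩⟩ := PB_shift 1 hX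
  obtain ⟨P', h1', ⟨b', hb'⟩, ⟨e'⟩⟩ := hZ
  have := kp_of P' h1' b' hb'
  obtain ⟨φ, hφ⟩ := kp_lift P' P (e'.inv ≫ h ≫ e.hom)
  have hT2 := rot_of_distTriang _ (rot_of_distTriang _ hT)
  have hT3 := DerivedCategory.mappingCone_triangle_distinguished φ
  have i3 := isoTriangleOfIso₁₂ _ _ hT2 hT3 e' e (by
    change h ≫ e.hom = e'.hom ≫ DerivedCategory.Q.map φ
    rw [hφ]; simp)
  have i4 : Y⟦(1:ℤ)⟧ ≅ QQ.{w} (CochainComplex.mappingCone φ) := Triangle.π₃.mapIso i3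
  have : PB (QQ.{w} (CochainComplex.mappingCone φ)) := by
    refine ⟨_, ?_, ⟨max b b', ?_⟩, ⟨Iso.refl _⟩⟩
    · intro i
      have := h1 i
      have := h1' (i + 1)
      exact Projective.of_iso (HomologicalComplex.homotopyCofiber.XIsoBiprod φ i (i + 1) rfl).symm inferInstance
    · intro i hi
      refine (HomologicalComplex.homotopyCofiber.XIsoBiprod φ i (i + 1) rfl).isZero_iff.2 ?_
      rw [biprod_isZero_iff]
      exact ⟨hb' _ (by omega), hb _ (by omega)⟩
  have := PB_shift (-1) (PB_iso i4.symm this)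
  exact PB_iso ((shiftEquiv (DR.{w,v} R) (1 : ℤ)).unitIso.symm.app Y) this

lemma PB_single (i : ℤ) (M : ModuleCat.{v} R) : PB.{w} (sg i M) := by
  have : EnoughProjectives (ModuleCat.{v} R) := ModuleCat.enoughProjectives.{v, 0} 
  obtain ⟨S⟩ := (HasProjectiveResolution.out : Nonempty (ProjectiveResolution M))
  have h0 : PB.{w} (sg 0 M) := by
    refine ⟨S.cochainComplex, inferInstance, ⟨0, fun i hi => S.cochainComplex.isZero_of_isStrictlyLE 0 i hi⟩, ⟨?_⟩⟩
    exact (asIso (DerivedCategory.Q.map S.π')).symm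
  exact PB_iso (sg_shift 0 (-i) i (by omega) M) (PB_shift (-i) h0)

lemma PB_all (M : DR.{w, v} R) (a b : ℤ) (ha : ∀ i, i < a → ∀ x : HH i M, x = 0) (hb : ∀ i, b < i → ∀ x : HH i M, x = 0) :
    PB M := by
  refine dev PB (fun X Y e => PB_iso e) ?_ PB_ext M a b ha hb (fun i => PB_single i _)
  intro X hX
  have : IsZero (sg.{w} 0 (ModuleCat.of R PUnit : ModuleCat.{v} R)) := (sF 0).map_isZero (ModuleCat.isZero_of_subsingleton _)
  exact PB_iso (this.iso hX) (PB_single 0 _)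

end Nul

namespace Nul
variable {R : Type} [CommRing R] [HasDerivedCategory.{w} (ModuleCat.{v} R)] {U : Set (DR.{w, v} R)}

lemma cdm2 {X Y Z X' Y' Z' : DR.{w, v} R} {f : X ⟶ Y} {g : Y ⟶ Z} {h : Z ⟶ X⟦(1 : ℤ)⟧}
    (hT : Triangle.mk f g h ∈ distTriang _) {f' : X' ⟶ Y'} {g' : Y' ⟶ Z'} {h' : Z' ⟶ X'⟦(1 : ℤ)⟧} 
    (hT' : Triangle.mk f' g' h' ∈ distTriang _) (a : X ⟶ X') (c : Z ⟶ Z') (w : h ≫ a⟦(1 : ℤ)⟧' = c ≫ h') :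
    ∃ b : Y ⟶ Y', f ≫ b = a ≫ f' := by
  obtain ⟨b, h1, h2⟩ := complete_distinguished_triangle_morphism₂ _ _ hT hT' a c w
  exact ⟨b, h1⟩

lemma retract_core (hU : IsCocompletePreaisle R U) (m : ℤ) (D C : ModuleCat.{v} R) (φ : D ⟶ D) (g : D ⟶ C) (wz : φ ≫ g = 0)
    (hS : (ShortComplex.mk φ g wz).ShortExact) (hφ : ∀ v : D ⟶ D, φ ≫ v = φ → v = 𝟙 D) (X : DR.{w, v} R) (hX : X ∈ U) (hC : sg m C ∈ U)
    (ι : sg m D ⟶ X) (π : X ⟶ sg m D) (h : ι ≫ π = (sF m).map φ) : sg m D ∈ U := by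
  obtain ⟨δ, hδ⟩ := sg_tri.{w} m _ hS
  obtain ⟨X'', i, r', hT2⟩ := distinguished_cocone_triangle₂ (δ ≫ ι⟦(1 : ℤ)⟧')
  have hX'' : X'' ∈ U := hU.ext_mem _ _ _ hT2 hX hC
  obtain ⟨u, hu⟩ := cdm2 hδ hT2 ι (𝟙 _) (Category.id_comp _).symm
  obtain ⟨r, hr⟩ := cdm2 hT2 (contractible_distinguished (sg m D)) π 0 (by
    rw [Category.assoc, ← Functor.map_comp, h, zero_comp]
    exact comp_distTriang_mor_zero₃₁ _ hδ)
  obtain ⟨v, hv⟩ := (sF m).map_surjective (u ≫ r)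
  have h1 : (sF m).map φ ≫ u ≫ r = (sF m).map φ := by
    have := congrArg (· ≫ r) hu
    simp only [Category.assoc, hr] at this
    refine this.trans ?_
    rw [← h]
    exact congrArg (ι ≫ ·) (Category.comp_id _)
  rw [← hv, ← Functor.map_comp] at h1
  have h2 := hφ v ((sF m).map_injective h1)
  rw [h2, CategoryTheory.Functor.map_id] at hv
  exact mem_retract hU u r hv.symm hX''

lemma retract_Rq [IsNoetherianRing R] (hU : IsCocompletePreaisle R U) (m : ℤ) (p : Ideal R) [p.IsPrime] (f : R) (hf : f ∉ p) 
    (IH : ∀ q : PrimeSpectrum R, p < q.asIdeal → sg m (Rq q.asIdeal) ∈ U)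
    (X : DR.{w, v} R) (hX : X ∈ U) (ι : sg m (Rq p) ⟶ X) (π : X ⟶ sg m (Rq p)) 
    (h : ι ≫ π = (sF m).map (ModuleCat.ofHom (f • LinearMap.id))) : sg m (Rq p) ∈ U := by
  let D := ULift.{v} (R ⧸ p)
  have hinj : Function.Injective (f • LinearMap.id : D →ₗ[R] D) := by
    rw [injective_iff_map_eq_zero]
    rintro ⟨x⟩ hx
    have : f • x = 0 := congrArg ULift.down hx
    rw [Algebra.smul_def, mul_eq_zero] at this
    rcases this with h | h
    · exact absurd (Ideal.Quotient.eq_zero_iff_mem.1 h) hf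
    · exact congrArg ULift.up h
  let N := LinearMap.range (f • LinearMap.id : D →ₗ[R] D)
  have hex : Function.Exact (f • LinearMap.id : D →ₗ[R] D) N.mkQ := LinearMap.exact_map_mkQ_range _
  refine retract_core hU m (Rq p) (ModuleCat.of R (D ⧸ N)) (ModuleCat.ofHom (f • LinearMap.id)) (ModuleCat.ofHom N.mkQ) ?_ ?_ ?_ X hX ?_ ι π h
  · rw [← ModuleCat.ofHom_comp, hex.linearMap_comp_eq_zero]; rfl
  · refine ShortComplex.ShortExact.mk' ?_ ?_ ?_
    · rw [ShortComplex.moduleCat_exact_iff]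
      intro x hx
      exact (hex x).1 hx
    · rw [ModuleCat.mono_iff_injective]
      exact hinj
    · rw [ModuleCat.epi_iff_surjective]
      exact N.mkQ_surjective
  · intro v hv
    ext x
    apply congrArg ULift.down
    apply hinj
    have := congrArg (fun k => k.hom x) hv
    change v.hom (f • x) = f • x at this
    rw [map_smul] at this
    exact this
  · apply single_mem hU m
    intro q hq
    apply IH
    have hle : Ideal.span {f} ⊔ p ≤ Module.annihilator R (D ⧸ N) := by
      rw [sup_le_iff, Ideal.span_singleton_le_iff_mem]
      constructor
      · rw [Module.mem_annihilator]
        intro y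
        obtain ⟨y, rfl⟩ := N.mkQ_surjective y
        rw [← map_smul]
        exact (hex _).2 ⟨y, rfl⟩
      · intro a ha
        rw [Module.mem_annihilator]
        intro y
        obtain ⟨⟨y⟩, rfl⟩ := N.mkQ_surjective y
        rw [← map_smul]
        have : a • (ULift.up y : D) = 0 := by
          apply ULift.ext
          change a • y = 0
          rw [Algebra.smul_def]
          erw [Ideal.Quotient.eq_zero_iff_mem.2 ha]
          exact zero_mul _
        rw [this, map_zero]
    rw [Module.mem_support_iff_of_finite] at hq
    have h2 := hle.trans hq
    refine lt_of_le_of_ne (le_sup_right.trans h2) ?_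
    rintro rfl
    exact hf (h2 (Ideal.mem_sup_left (Ideal.mem_span_singleton_self f)))

end Nul

namespace Nul
variable {R : Type} [CommRing R]

lemma single_comp_single (K : Cx.{v} R) (m : ℤ) (A B : ModuleCat.{v} R) (a : A ⟶ K.X m) (b : K.X m ⟶ B) 
    (ha : ∀ k, (ComplexShape.up ℤ).Rel m k → a ≫ K.d m k = 0) (hb : ∀ i, (ComplexShape.up ℤ).Rel i m → K.d i m ≫ b = 0)
    (c : A ⟶ B) (h : a ≫ b = c) : 
    HomologicalComplex.mkHomFromSingle a ha ≫ HomologicalComplex.mkHomToSingle b hb = (sC m).map c := by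
  apply HomologicalComplex.from_single_hom_ext
  rw [HomologicalComplex.comp_f, HomologicalComplex.mkHomFromSingle_f, HomologicalComplex.mkHomToSingle_f,
    HomologicalComplex.single_map_f_self, Category.assoc, ← h, Category.assoc]

lemma ten_retract (P : Cx.{v} R) (m : ℤ) (p : Ideal R) (z : P.X m) (hz : (P.d m (m+1)).hom z = 0)
    (b0 : P.X m →ₗ[R] ULift.{v} (R ⧸ p)) (hb0 : ∀ i, i + 1 = m → b0 ∘ₗ (P.d i m).hom = 0) (f : R) 
    (hf : (b0 z).down = Ideal.Quotient.mk p f) :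
    ∃ (ι : (sC m).obj (Rq p) ⟶ tenC (R ⧸ p) P) (π : tenC (R ⧸ p) P ⟶ (sC m).obj (Rq p)),
      ι ≫ π = (sC m).map (ModuleCat.ofHom (f • LinearMap.id)) := by
  let ι0 : ULift.{v} (R ⧸ p) →ₗ[R] (R ⧸ p) ⊗[R] P.X m := 
    (TensorProduct.mk R (R ⧸ p) (P.X m)).flip z ∘ₗ ULift.moduleEquiv.toLinearMap
  let b1 : P.X m →ₗ[R] R ⧸ p := ULift.moduleEquiv.toLinearMap ∘ₗ b0
  have hb1 : ∀ i, i + 1 = m → b1 ∘ₗ (P.d i m).hom = 0 := by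
    intro i hi
    rw [LinearMap.comp_assoc, hb0 i hi, LinearMap.comp_zero]
  let π0 : (R ⧸ p) ⊗[R] P.X m →ₗ[R] ULift.{v} (R ⧸ p) := 
    ULift.moduleEquiv.symm.toLinearMap ∘ₗ TensorProduct.lift ((LinearMap.mul R (R ⧸ p)).compl₂ b1)
  have h1 : ∀ k, (ComplexShape.up ℤ).Rel m k → ModuleCat.ofHom ι0 ≫ (tenC (R ⧸ p) P).d m k = 0 := by
    intro k hk
    obtain rfl : m + 1 = k := hk
    change ModuleCat.ofHom ι0 ≫ ModuleCat.ofHom (LinearMap.lTensor (R ⧸ p) (P.d m (m+1)).hom) = 0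
    rw [← ModuleCat.ofHom_comp]
    have : LinearMap.lTensor (R ⧸ p) (P.d m (m+1)).hom ∘ₗ ι0 = 0 := by
      apply LinearMap.ext
      intro x
      change LinearMap.lTensor (R ⧸ p) (P.d m (m+1)).hom (x.down ⊗ₜ z) = 0
      rw [LinearMap.lTensor_tmul, hz, TensorProduct.tmul_zero]
    rw [this]; rfl
  have h2 : ∀ i, (ComplexShape.up ℤ).Rel i m → (tenC (R ⧸ p) P).d i m ≫ ModuleCat.ofHom π0 = 0 := by
    intro i hi
    change ModuleCat.ofHom (LinearMap.lTensor (R ⧸ p) (P.d i m).hom) ≫ ModuleCat.ofHom π0 = 0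
    rw [← ModuleCat.ofHom_comp]
    have : π0 ∘ₗ LinearMap.lTensor (R ⧸ p) (P.d i m).hom = 0 := by
      apply TensorProduct.ext'
      intro x y
      change ULift.up (x * b1 ((P.d i m).hom y)) = 0
      have := LinearMap.congr_fun (hb1 i hi) y
      rw [LinearMap.comp_apply] at this
      rw [this, LinearMap.zero_apply, mul_zero]; rfl
    rw [this]; rfl
  refine ⟨HomologicalComplex.mkHomFromSingle (ModuleCat.ofHom ι0) h1, HomologicalComplex.mkHomToSingle (ModuleCat.ofHom π0) h2, ?_⟩
  apply single_comp_single
  have : ModuleCat.ofHom ι0 ≫ ModuleCat.ofHom π0 = ModuleCat.ofHom (f • LinearMap.id) := by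
    rw [← ModuleCat.ofHom_comp]
    congr 1
    apply LinearMap.ext
    rintro ⟨x⟩
    change ULift.up (x * (b0 z).down) = ULift.up (f • x)
    rw [hf, mul_comm, Algebra.smul_def]; rfl
  exact this

lemma cyc_exists (P K : Cx.{v} R) (m : ℤ) (b : P ⟶ K) (x : P.homology m) (hx : HomologicalComplex.homologyMap b m x ≠ 0) :
    ∃ z : P.X m, (P.d m (m+1)).hom z = 0 ∧ (b.f m).hom z ≠ 0 := by
  obtain ⟨y, rfl⟩ := (ModuleCat.epi_iff_surjective (P.homologyπ m)).1 inferInstance x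
  refine ⟨(P.iCycles m).hom y, ?_, ?_⟩
  · have := P.iCycles_d m (m+1)
    exact congrArg (fun k => k.hom y) this
  · intro h
    apply hx
    have h1 := congrArg (fun k => k.hom y) (HomologicalComplex.cyclesMap_i b m)
    have h2 : (HomologicalComplex.cyclesMap b m).hom y = 0 := by
      apply (ModuleCat.mono_iff_injective (K.iCycles m)).1 inferInstance
      refine Eq.trans h1 (Eq.trans h (map_zero _).symm)
    have h3 := congrArg (fun k => k.hom y) (HomologicalComplex.homologyπ_naturality b m)
    refine Eq.trans h3 ?_
    change (K.homologyπ m).hom ((HomologicalComplex.cyclesMap b m).hom y) = 0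
    rw [h2, map_zero]

variable [HasDerivedCategory.{w} (ModuleCat.{v} R)] {U : Set (DR.{w, v} R)}

lemma key [IsNoetherianRing R] (hU : IsCocompletePreaisle R U) (m : ℤ) (p : Ideal R) [p.IsPrime]
    (IH : ∀ q : PrimeSpectrum R, p < q.asIdeal → sg m (Rq q.asIdeal) ∈ U)
    (M : DR.{w, v} R) (hM : M ∈ U) (hPB : PB M) (β : M ⟶ sg m (Rq p)) (x : HH m M) (hx : hm m β x ≠ 0) :
    sg m (Rq p) ∈ U := by
  obtain ⟨P, h1, ⟨b, hb⟩, ⟨e⟩⟩ := hPB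
  have := kp_of.{w} P h1 b hb
  have hflat : ∀ i, Module.Flat R (P.X i) := by
    intro i
    have := h1 i
    have : Module.Projective R (P.X i) := (IsProjective.iff_projective (P.X i)).2 inferInstance
    infer_instance
  obtain ⟨φ, hφ⟩ := kp_lift P ((sC m).obj (Rq p)) (e.inv ≫ β)
  have hx' : hm m (DerivedCategory.Q.map φ) (hm m e.hom x) ≠ 0 := by
    rw [hφ]
    intro h
    apply hx
    have : β = e.hom ≫ e.inv ≫ β := by simp
    rw [this, hm_comp]
    exact h
  set ff := DerivedCategory.homologyFunctorFactors (ModuleCat.{v} R) m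
  obtain ⟨y, hy⟩ : ∃ y : P.homology m, (ff.inv.app P) y = hm m e.hom x := 
    ⟨ff.hom.app P (hm m e.hom x), by
      rw [← ModuleCat.comp_apply, Iso.hom_inv_id_app]; rfl⟩
  rw [← hy, hQ_nat] at hx'
  obtain ⟨z, hz, hz2⟩ := cyc_exists P _ m φ y (by
    intro h
    rw [h] at hx'
    exact hx' (map_zero _))
  set s := (HomologicalComplex.singleObjXSelf (ComplexShape.up ℤ) m (Rq.{v} p))
  let b0 : P.X m →ₗ[R] ULift.{v} (R ⧸ p) := (φ.f m ≫ s.hom).hom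
  have hb0 : ∀ i, i + 1 = m → b0 ∘ₗ (P.d i m).hom = 0 := by
    intro i hi
    have : P.d i m ≫ φ.f m ≫ s.hom = 0 := by
      rw [← Category.assoc, ← φ.comm]
      simp
    exact congrArg ModuleCat.Hom.hom this
  have hne : (b0 z).down ≠ 0 := by
    intro h
    apply hz2
    have h' : s.hom.hom ((φ.f m).hom z) = 0 := ULift.ext _ _ h
    apply (ModuleCat.mono_iff_injective s.hom).1 inferInstance
    exact h'.trans (map_zero _).symm
  obtain ⟨f, hf⟩ := Ideal.Quotient.mk_surjective (b0 z).down
  have hfp : f ∉ p := by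
    intro h
    apply hne
    rw [← hf]
    exact Ideal.Quotient.eq_zero_iff_mem.2 h
  obtain ⟨ι, π, hιπ⟩ := ten_retract P m p z hz b0 hb0 f hf.symm
  refine retract_Rq hU m p f hfp IH (QQ.{w} (tenC (R ⧸ p) P)) 
    (tenC_mem hU P hflat b hb (hU.mem_of_iso e hM) _) (DerivedCategory.Q.map ι) (DerivedCategory.Q.map π) ?_
  exact (CategoryTheory.Functor.map_comp DerivedCategory.Q ι π).symm.trans (congrArg (fun k => DerivedCategory.Q.map k) hιπ)

end Nul

namespace Nul
variable {R : Type} [CommRing R]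

lemma exists_map_quot (N : Type v) [AddCommGroup N] [Module R N] [Module.Finite R N] (p : PrimeSpectrum R) 
    (hp : p ∈ Module.support R N) : ∃ θ : N →ₗ[R] R ⧸ p.asIdeal, θ ≠ 0 := by
  rw [Module.mem_support_iff_nontrivial_residueField_tensorProduct] at hp
  obtain ⟨n, hn⟩ : ∃ n : N, (1 : p.asIdeal.ResidueField) ⊗ₜ[R] n ≠ 0 := by
    by_contra! hcon
    obtain ⟨x, hx⟩ := exists_ne (0 : p.asIdeal.ResidueField ⊗[R] N)
    apply hx
    induction x using TensorProduct.induction_on with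
    | zero => rfl
    | tmul k n =>
      have : k ⊗ₜ[R] n = k • ((1 : p.asIdeal.ResidueField) ⊗ₜ[R] n) := by
        rw [TensorProduct.smul_tmul', smul_eq_mul, mul_one]
      rw [this, hcon, smul_zero]
    | add x y ihx ihy =>
      by_cases h : x = 0
      · by_cases h' : y = 0
        · rw [h, h', add_zero]
        · exact absurd (ihy h') h'
      · exact absurd (ihx h) h
  obtain ⟨l, hl⟩ : ∃ l : Module.Dual p.asIdeal.ResidueField (p.asIdeal.ResidueField ⊗[R] N), l (1 ⊗ₜ n) ≠ 0 := by
    by_contra! hcon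
    exact hn ((Module.forall_dual_apply_eq_zero_iff _ _).1 hcon)
  let ψ : N →ₗ[R] p.asIdeal.ResidueField := (l.restrictScalars R) ∘ₗ (TensorProduct.mk R p.asIdeal.ResidueField N 1)
  have hψ : ψ n ≠ 0 := hl
  obtain ⟨s, hs⟩ := Module.Finite.fg_top (R := R) (M := N)
  classical
  obtain ⟨⟨b, hb0⟩, hb⟩ := IsLocalization.exist_integer_multiples_of_finset (nonZeroDivisors (R ⧸ p.asIdeal)) (s.image ψ)
  let j : (R ⧸ p.asIdeal) →ₗ[R] p.asIdeal.ResidueField := (Algebra.linearMap (R ⧸ p.asIdeal) p.asIdeal.ResidueField).restrictScalars R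
  have hj : Function.Injective j := IsFractionRing.injective (R ⧸ p.asIdeal) p.asIdeal.ResidueField
  let mb : p.asIdeal.ResidueField →ₗ[R] p.asIdeal.ResidueField := (LinearMap.lsmul (R ⧸ p.asIdeal) p.asIdeal.ResidueField b).restrictScalars R
  have hr : ∀ x, mb (ψ x) ∈ LinearMap.range j := by
    have : (⊤ : Submodule R N) ≤ (LinearMap.range j).comap (mb ∘ₗ ψ) := by
      rw [← hs, Submodule.span_le]
      intro x hx
      obtain ⟨y, hy⟩ := hb (ψ x) (Finset.mem_image_of_mem _ hx)
      exact ⟨y, hy⟩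
    exact fun x => this trivial
  refine ⟨(LinearEquiv.ofInjective j hj).symm.toLinearMap ∘ₗ (mb ∘ₗ ψ).codRestrict (LinearMap.range j) hr, fun h => ?_⟩
  have h1 := LinearMap.congr_fun h n
  simp only [LinearMap.comp_apply, LinearEquiv.coe_coe, LinearMap.zero_apply, LinearEquiv.map_eq_zero_iff] at h1
  have h2 : b • ψ n = 0 := congrArg Subtype.val h1
  rw [Algebra.smul_def, mul_eq_zero] at h2
  rcases h2 with h2 | h2
  · have : b = 0 := hj (h2.trans (map_zero j).symm)
    exact nonZeroDivisors.ne_zero hb0 this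
  · exact hψ h2

variable [HasDerivedCategory.{w} (ModuleCat.{v} R)] {U : Set (DR.{w, v} R)}

lemma kill (p : PrimeSpectrum R) (B : DR.{w, v} R) (a b : ℤ) (ha : ∀ i, i < a → ∀ x : HH i B, x = 0) 
    (hb : ∀ i, b < i → ∀ x : HH i B, x = 0) (hs : ∀ i, ∃ c ∉ p.asIdeal, ∀ x : HH i B, c • x = 0) :
    ∃ c ∉ p.asIdeal, c • 𝟙 B = 0 := by
  refine dev (fun X => ∃ c ∉ p.asIdeal, c • 𝟙 X = 0) ?_ ?_ ?_ B a b ha hb ?_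
  · rintro X Y e ⟨c, hc, h⟩
    refine ⟨c, hc, ?_⟩
    have : c • 𝟙 Y = e.inv ≫ (c • 𝟙 X) ≫ e.hom := by simp
    rw [this, h]; simp
  · intro X hX
    exact ⟨1, p.2.one_notMem, hX.eq_of_src _ _⟩
  · rintro X Y Z f g h hT ⟨c, hc, h1⟩ ⟨d, hd, h2⟩
    refine ⟨c * d, fun h => (p.2.mem_or_mem h).elim hc hd, ?_⟩
    obtain ⟨k, hk⟩ := coy2 hT (d • 𝟙 Y) (by
      have : (d • 𝟙 Y) ≫ g = g ≫ (d • 𝟙 Z) := by simp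
      rw [this, h2, comp_zero])
    rw [mul_smul, hk]
    have : c • (k ≫ f) = k ≫ (c • 𝟙 X) ≫ f := by simp
    rw [this, h1]; simp
  · intro i
    obtain ⟨c, hc, h⟩ := hs i
    refine ⟨c, hc, ?_⟩
    have : c • 𝟙 (HH i B) = 0 := by
      ext x
      exact h x
    have h2 : c • 𝟙 (sg.{w} i (HH i B)) = (sF i).map (c • 𝟙 (HH i B)) := by
      rw [Functor.map_smul, CategoryTheory.Functor.map_id]
    rw [h2, this, Functor.map_zero]

lemma hm_sF (m : ℤ) (X Y : ModuleCat.{v} R) (θ : X ⟶ Y) (x : X) : 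
    hm m ((sF.{w} m).map θ) ((HH_sg m X).inv.hom x) = (HH_sg m Y).inv.hom (θ.hom x) := by
  have := (DerivedCategory.singleFunctorCompHomologyFunctorIso (ModuleCat.{v} R) m).inv.naturality θ
  exact (congrArg (fun (f : X ⟶ HH m (sg m Y)) => f.hom x) this).symm

lemma exists_beta [IsNoetherianRing R] (m : ℤ) (p : PrimeSpectrum R) (M : DR.{w, v} R) (b : ℤ) 
    (hb : ∀ i, b < i → ∀ x : HH i M, x = 0) (hfin : ∀ i, Module.Finite R (HH i M))
    (hp : p ∈ Module.support R (HH m M)) (hp' : ∀ i, m < i → p ∉ Module.support R (HH i M)) :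
    ∃ (β : M ⟶ sg m (Rq p.asIdeal)) (x : HH m M), hm m β x ≠ 0 := by
  obtain ⟨A, B, f, g, h, hT, hA, hB, hA', hB', hf, hg⟩ := trunc M (m + 1)
  obtain ⟨c, hc, hcB⟩ := kill p B (m + 1) b hB' (by
    intro i hi x
    rcases lt_or_ge i (m + 1) with h | h
    · exact hB' i h x
    · obtain ⟨x, rfl⟩ := (hg i h).2 x
      rw [hb i hi x, map_zero]) (by
    intro i
    rcases lt_or_ge i (m + 1) with h | h
    · exact ⟨1, p.2.one_notMem, fun x => by rw [one_smul]; exact hB' i h x⟩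
    · have h1 := hp' i (by omega)
      have := hfin i
      rw [Module.mem_support_iff_of_finite, SetLike.not_le_iff_exists] at h1
      obtain ⟨c, hc, hc'⟩ := h1
      refine ⟨c, hc', fun x => ?_⟩
      obtain ⟨x, rfl⟩ := (hg i h).2 x
      rw [← map_smul, (Module.mem_annihilator.1 hc) x, map_zero])
  obtain ⟨A2, B2, f2, g2, h2, hT2, hA2, hB2, hA2', hB2', hf2, hg2⟩ := trunc A m
  have hB2le : B2.IsLE m := by
    rw [DerivedCategory.isLE_iff]
    intro i hi
    have : Subsingleton (HH i B2) := by
      refine ⟨fun x y => ?_⟩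
      obtain ⟨x, rfl⟩ := (hg2 i (by omega)).2 x
      obtain ⟨y, rfl⟩ := (hg2 i (by omega)).2 y
      rw [hA' i (by omega) x, hA' i (by omega) y]
    exact ModuleCat.isZero_of_subsingleton _
  obtain ⟨Y, ⟨e⟩⟩ := DerivedCategory.exists_iso_singleFunctor_obj_of_isGE_of_isLE B2 m
  let i1 : HH m M ≅ Y := (isoOfBij _ (hf m (by omega))).symm ≪≫ isoOfBij _ (hg2 m le_rfl) ≪≫ 
    (DerivedCategory.homologyFunctor _ m).mapIso e ≪≫ HH_sg m Y
  let i2 : HH m M ≃ₗ[R] Y := i1.toLinearEquiv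
  have := hfin m
  have : Module.Finite R Y := Module.Finite.equiv i2
  obtain ⟨θ, hθ⟩ := exists_map_quot Y p (by rwa [i2.support_eq] at hp)
  let θ' : Y ⟶ Rq.{v} p.asIdeal := ModuleCat.ofHom (ULift.moduleEquiv.symm.toLinearMap ∘ₗ θ)
  let π : A ⟶ sg m Y := g2 ≫ e.hom
  have hh : h ≫ (π ≫ (sF m).map (c • θ'))⟦(1 : ℤ)⟧' = 0 := by
    rw [Functor.map_smul, Linear.comp_smul, Functor.map_smul, Linear.comp_smul]
    have : ∀ (W : DR.{w, v} R) (k : B ⟶ W), c • k = 0 := by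
      intro W k
      have : c • k = (c • 𝟙 B) ≫ k := by simp
      rw [this, hcB, zero_comp]
    exact this _ _
  obtain ⟨β, hβ⟩ := cdm2 hT (contractible_distinguished (sg m (Rq p.asIdeal))) (π ≫ (sF m).map (c • θ')) 0 (by
    rw [hh, zero_comp])
  have hβ' : f ≫ β = π ≫ (sF m).map (c • θ') := hβ.trans (Category.comp_id _)
  obtain ⟨y, hy⟩ : ∃ y, θ y ≠ 0 := by
    by_contra! hcon
    exact hθ (LinearMap.ext hcon)
  obtain ⟨x, hx⟩ : ∃ x : HH m A, hm m π x = (HH_sg m Y).inv.hom y := by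
    obtain ⟨x, hx⟩ := (hg2 m le_rfl).2 (hm m e.inv ((HH_sg m Y).inv.hom y))
    refine ⟨x, ?_⟩
    rw [hm_comp, hx, ← hm_comp, e.inv_hom_id, hm_id]
  refine ⟨β, hm m f x, fun h0 => ?_⟩
  rw [← hm_comp, hβ', hm_comp, hx, hm_sF] at h0
  have h3 : (c • θ').hom y = 0 := by
    apply (ModuleCat.mono_iff_injective (HH_sg m (Rq p.asIdeal)).inv).1 inferInstance
    exact h0.trans (map_zero _).symm
  have h4 : c • θ y = 0 := congrArg ULift.down h3
  rw [Algebra.smul_def, mul_eq_zero] at h4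
  rcases h4 with h4 | h4
  · exact hc (Ideal.Quotient.eq_zero_iff_mem.1 h4)
  · exact hy h4

end Nul

namespace Nul
variable {R : Type} [CommRing R] [HasDerivedCategory.{w} (ModuleCat.{v} R)] {U : Set (DR.{w, v} R)}

lemma bounds (M : DR.{w, v} R) (h : memDqc R M) : ∃ a b : ℤ, (∀ i, i < a → ∀ x : HH i M, x = 0) ∧ (∀ i, b < i → ∀ x : HH i M, x = 0) := by
  obtain ⟨⟨lo, hlo⟩, hi, hhi⟩ := And.intro h.2.bddBelow h.2.bddAbove
  have key : ∀ i, (¬ (lo ≤ -i) ∨ ¬ (-i ≤ hi)) → ∀ x : HH i M, x = 0 := by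
    intro i hi' x
    have hz : IsZero (Hh R (-i) M) := by
      by_contra hcon
      rcases hi' with h' | h'
      · exact h' (hlo hcon)
      · exact h' (hhi hcon)
    have hz' : IsZero (HH i M) := by
      have : Hh R (-i) M = HH i M := by
        change HH (- -i) M = HH i M
        rw [neg_neg]
      rwa [this] at hz
    have := ModuleCat.subsingleton_of_isZero hz'
    exact Subsingleton.elim _ _
  exact ⟨-hi, -lo, fun i h' => key i (Or.inr (by omega)), fun i h' => key i (Or.inl (by omega))⟩

lemma fin_HH (M : DR.{w, v} R) (h : memDqc R M) (i : ℤ) : Module.Finite R (HH i M) := by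
  have := h.1 (-i)
  change Module.Finite R (HH (- -i) M) at this
  rwa [neg_neg] at this

lemma supp_mem [IsNoetherianRing R] (hU : IsCocompletePreaisle R U) (M : DR.{w, v} R) (hM : M ∈ U) (hq : memDqc R M)
    (p : PrimeSpectrum R) : ∀ i, p ∈ Module.support R (HH i M) → sg i (Rq p.asIdeal) ∈ U := by
  obtain ⟨a, b, ha, hb⟩ := bounds M hq
  have hfin := fin_HH M hq
  have wf : WellFounded (fun q p : PrimeSpectrum R => p < q) := by
    have : WellFounded (fun I J : Ideal R => I > J) := wellFounded_gt
    exact InvImage.wf PrimeSpectrum.asIdeal this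
  induction p using wf.induction with
  | _ p ih =>
  intro i hi
  obtain ⟨m, him, hm1, hm2⟩ : ∃ m, i ≤ m ∧ p ∈ Module.support R (HH m M) ∧ ∀ j, m < j → p ∉ Module.support R (HH j M) := by
    obtain ⟨m, ⟨h1, h2⟩, h3⟩ := Int.exists_greatest_of_bdd (P := fun m => i ≤ m ∧ p ∈ Module.support R (HH m M)) 
      ⟨b, fun z hz => by
        by_contra! hcon
        have : Subsingleton (HH z M) := ⟨fun x y => by rw [hb z hcon x, hb z hcon y]⟩
        have h0 := hz.2
        rw [Module.support_eq_empty] at h0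
        exact h0⟩ ⟨i, le_rfl, hi⟩
    exact ⟨m, h1, h2, fun j hj hc => by have := h3 j ⟨by omega, hc⟩; omega⟩
  obtain ⟨β, x, hx⟩ := exists_beta m p M b hb hfin hm1 hm2
  have := p.2
  have hmU : sg m (Rq p.asIdeal) ∈ U := by
    refine key hU m p.asIdeal ?_ M hM (PB_all M a b ha hb) β x hx
    intro q hpq
    have := hfin m
    refine ih q hpq m ?_
    rw [Module.mem_support_iff_of_finite] at hm1 ⊢
    exact hm1.trans hpq.le
  have h2 := mem_shift hU (m - i).toNat hmU
  exact hU.mem_of_iso (sg_shift m _ i (by rw [Int.toNat_of_nonneg (by omega)]; omega) _) h2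

lemma phi_iff [IsNoetherianRing R] (A : Set (DR.{w, v} R)) (hA : ∀ M ∈ A, memDqc R M) (n : ℤ) (p : PrimeSpectrum R) : 
    p ∈ phi R A n ↔ ∃ M ∈ A, p ∈ Module.support R (HH (-n) M) := by
  constructor
  · rintro ⟨M, hM, q, hq, hqp⟩
    refine ⟨M, hM, ?_⟩
    have := fin_HH M (hA M hM) (-n)
    rw [Module.mem_support_iff_of_finite]
    exact (le_of_eq_of_le Submodule.annihilator_top.symm (IsAssociatedPrime.annihilator_le hq)).trans hqp
  · rintro ⟨M, hM, hp⟩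
    have := fin_HH M (hA M hM) (-n)
    rw [Module.mem_support_iff_of_finite] at hp
    obtain ⟨q, hq, hqp⟩ := Ideal.exists_minimalPrimes_le hp
    have : Module.Finite R (Hh R n M) := this
    exact ⟨M, hM, q, Module.associatedPrimes.minimalPrimes_annihilator_subset_associatedPrimes R _ hq, hqp⟩

lemma main_sub [IsNoetherianRing R] (A A' : Set (DR.{w, v} R)) (hA : IsNullityClass R A) (hA' : IsNullityClass R A')
    (h : ∀ n, phi R A n ⊆ phi R A' n) : A ⊆ A' := by
  obtain ⟨U, hU, rfl⟩ := hA
  obtain ⟨U', hU', rfl⟩ := hA'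
  rintro M ⟨hM, hMq⟩
  refine ⟨?_, hMq⟩
  obtain ⟨a, b, ha, hb⟩ := bounds M hMq
  refine bounded_mem hU' M a b ha hb (fin_HH M hMq) ?_
  intro i q hq
  have h1 : q ∈ phi R (U ∩ {M | memDqc R M}) (-i) := by
    rw [phi_iff _ (fun M hM => hM.2)]
    exact ⟨M, ⟨hM, hMq⟩, by rwa [neg_neg]⟩
  have h2 := h (-i) h1
  rw [phi_iff _ (fun M hM => hM.2)] at h2
  obtain ⟨M', ⟨hM', hM'q⟩, h3⟩ := h2
  rw [neg_neg] at h3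
  exact supp_mem hU' M' hM' hM'q q i h3

lemma main [IsNoetherianRing R] (A A' : Set (DR.{w, v} R)) (hA : IsNullityClass R A) (hA' : IsNullityClass R A') :
    (A ⊆ A' ↔ ∀ n, phi R A n ⊆ phi R A' n) ∧ (phi R A = phi R A' → A = A') := by
  refine ⟨⟨?_, main_sub A A' hA hA'⟩, fun h => ?_⟩
  · rintro h n p ⟨M, hM, r⟩
    exact ⟨M, h hM, r⟩
  · exact Set.Subset.antisymm (main_sub _ _ hA hA' fun n => by rw [h]) (main_sub _ _ hA' hA fun n => by rw [h])

end Nul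

/-- For nullity classes `A, A'` in `D_qc(R)`: `A ⊆ A'` iff
`φ(A)(n) ⊆ φ(A')(n)` for all `n`. In particular `φ` is injective on nullity classes. -/
theorem stmt15 (R : Type) [CommRing R] [IsNoetherianRing R]
    [HasDerivedCategory.{w} (ModuleCat R)]
    (A A' : Set (DerivedCategory (ModuleCat R)))
    (hA : IsNullityClass R A) (hA' : IsNullityClass R A') :
    (A ⊆ A' ↔ ∀ n : ℤ, phi R A n ⊆ phi R A' n) ∧
      (phi R A = phi R A' → A = A') := by
  exact Nul.main A A' hA hA'
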